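/- Let 0 < α < n, 1 < p < n/α and 1/q = 1/p − α/n. Let Ω be homogeneous of degree zero, have mean value zero on S^{n−1}, and be a Lipschitz function. Then for every η with 1 < η < n/α there exists a constant C, independent of f and b, such that for all b ∈ BMO(ℝ^n), all f ∈ L^p(ℝ^n), and all x ∈ ℝ^n: M^♯([b, T_{Ω,α}]f)(x) ≤ C ‖b‖_{BMO} [ ( M(|T_{Ω,α} f|^η)(x) )^{1/η} + ( M_{αη}(|f|^η)(x) )^{1/η} ]. -/

import Mathlib

open MeasureTheory ENNReal Metric

noncomputable section

/-- The (closed) cube centered at `x` with side length `r`. -/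
def cube {n : ℕ} (x : EuclideanSpace ℝ (Fin n)) (r : ℝ) : Set (EuclideanSpace ℝ (Fin n)) :=
  {y | ∀ i, |y i - x i| ≤ r / 2}

/-- The average `f_Q = |Q|⁻¹ ∫_Q f` of `f` over a set `Q`. -/
def setAvg {n : ℕ} (Q : Set (EuclideanSpace ℝ (Fin n))) (f : EuclideanSpace ℝ (Fin n) → ℝ) : ℝ :=
  (volume Q).toReal⁻¹ * ∫ y in Q, f y

/-- Slice norm of an `ℝ≥0∞`-valued function. -/
def sliceNormE {n : ℕ} (p q t : ℝ) (g : EuclideanSpace ℝ (Fin n) → ℝ≥0∞) : ℝ≥0∞ :=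
  (∫⁻ x, ((volume (cube x t))⁻¹ * ∫⁻ y in cube x t, g y ^ p) ^ (q / p)) ^ (1 / q)

/-- The slice space norm `‖f‖_{(E_p^q)_t}`. -/
def sliceNorm {n : ℕ} (p q t : ℝ) (f : EuclideanSpace ℝ (Fin n) → ℝ) : ℝ≥0∞ :=
  sliceNormE p q t fun y => ENNReal.ofReal |f y|

/-- Membership in the slice space `(E_p^q)_t(ℝⁿ)`. -/
def MemSlice {n : ℕ} (p q t : ℝ) (f : EuclideanSpace ℝ (Fin n) → ℝ) : Prop :=
  Measurable f ∧ sliceNorm p q t f ≠ ∞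

/-- The BMO seminorm, as a supremum over all cubes. -/
def bmoNorm {n : ℕ} (b : EuclideanSpace ℝ (Fin n) → ℝ) : ℝ≥0∞ :=
  ⨆ (x : EuclideanSpace ℝ (Fin n)) (r : ℝ) (_ : 0 < r),
    (volume (cube x r))⁻¹ * ∫⁻ y in cube x r, ENNReal.ofReal |b y - setAvg (cube x r) b|

/-- Membership in `BMO(ℝⁿ)`. -/
def MemBMO {n : ℕ} (b : EuclideanSpace ℝ (Fin n) → ℝ) : Prop :=
  LocallyIntegrable b volume ∧ bmoNorm b ≠ ∞

/-- `Ω` is homogeneous of degree zero. -/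
def HomogZero {n : ℕ} (Ω : EuclideanSpace ℝ (Fin n) → ℝ) : Prop :=
  ∀ lam : ℝ, 0 < lam → ∀ x : EuclideanSpace ℝ (Fin n), x ≠ 0 → Ω (lam • x) = Ω x

/-- `Ω` has mean value zero on the unit sphere. -/
def MeanZeroOnSphere {n : ℕ} (Ω : EuclideanSpace ℝ (Fin n) → ℝ) : Prop :=
  ∫ x : sphere (0 : EuclideanSpace ℝ (Fin n)) 1, Ω x
    ∂((volume : Measure (EuclideanSpace ℝ (Fin n))).toSphere) = 0

/-- The fractional integral operator with rough kernel,
`T_{Ω,α} f (x) = ∫ Ω(x-y) |x-y|^{α-n} f(y) dy`. -/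
def fracInt {n : ℕ} (Ω : EuclideanSpace ℝ (Fin n) → ℝ) (α : ℝ)
    (f : EuclideanSpace ℝ (Fin n) → ℝ) (x : EuclideanSpace ℝ (Fin n)) : ℝ :=
  ∫ y, Ω (x - y) * ‖x - y‖ ^ (α - n) * f y

/-- The commutator `[b, T_{Ω,α}] f = b ⬝ T_{Ω,α} f - T_{Ω,α}(b f)`. -/
def commutatorOp {n : ℕ} (Ω : EuclideanSpace ℝ (Fin n) → ℝ) (α : ℝ)
    (b f : EuclideanSpace ℝ (Fin n) → ℝ) : EuclideanSpace ℝ (Fin n) → ℝ :=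
  fun x => b x * fracInt Ω α f x - fracInt Ω α (fun y => b y * f y) x

/-- The fractional maximal operator `M_γ` (over cubes); `γ = 0` gives the
Hardy–Littlewood maximal operator. -/
def fracMax {n : ℕ} (γ : ℝ) (f : EuclideanSpace ℝ (Fin n) → ℝ)
    (x : EuclideanSpace ℝ (Fin n)) : ℝ≥0∞ :=
  ⨆ (z : EuclideanSpace ℝ (Fin n)) (r : ℝ) (_ : 0 < r) (_ : x ∈ cube z r),
    volume (cube z r) ^ (γ / n - 1) * ∫⁻ y in cube z r, ENNReal.ofReal |f y|

/-- The Fefferman–Stein sharp maximal operator `M^♯`. -/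
def sharpMax {n : ℕ} (f : EuclideanSpace ℝ (Fin n) → ℝ)
    (x : EuclideanSpace ℝ (Fin n)) : ℝ≥0∞ :=
  ⨆ (z : EuclideanSpace ℝ (Fin n)) (r : ℝ) (_ : 0 < r) (_ : x ∈ cube z r),
    (volume (cube z r))⁻¹ * ∫⁻ y in cube z r, ENNReal.ofReal |f y - setAvg (cube z r) f|

/-- The `L^p` norm. -/
def lpNorm {n : ℕ} (p : ℝ) (f : EuclideanSpace ℝ (Fin n) → ℝ) : ℝ≥0∞ :=
  (∫⁻ x, ENNReal.ofReal |f x| ^ p) ^ (1 / p)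

/-- The set of admissible Hölder–Lipschitz constants of order `β` for `b`. -/
def LipConstSet {n : ℕ} (β : ℝ) (b : EuclideanSpace ℝ (Fin n) → ℝ) : Set ℝ :=
  {C : ℝ | ∀ x y, |b x - b y| ≤ C * dist x y ^ β}

/-- Membership in the Lipschitz space `Lip_β(ℝⁿ)`. -/
def MemLip {n : ℕ} (β : ℝ) (b : EuclideanSpace ℝ (Fin n) → ℝ) : Prop :=
  (LipConstSet β b).Nonempty

/-- The `Lip_β` norm: the least admissible constant. -/
def lipNorm {n : ℕ} (β : ℝ) (b : EuclideanSpace ℝ (Fin n) → ℝ) : ℝ :=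
  sInf (LipConstSet β b)

theorem enorm_sub_mul_measure_le {X : Type*} [MeasurableSpace X] (μ : Measure X) {b : X → ℝ}
    (hb : AEMeasurable b μ) (c c' : ℝ) {s t : Set X}
    (hst : s ⊆ t) :
    ‖c - c'‖ₑ * μ s ≤ ∫⁻ y in s, ‖b y - c‖ₑ ∂μ + ∫⁻ y in t, ‖b y - c'‖ₑ ∂μ := by
  calc ‖c - c'‖ₑ * μ s = ∫⁻ _ in s, ‖c - c'‖ₑ ∂μ := by simp
    _ ≤ ∫⁻ y in s, (‖b y - c‖ₑ + ‖b y - c'‖ₑ) ∂μ := by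
        refine lintegral_mono fun y ↦ ?_
        rw [← enorm_neg (b y - c), show c - c' = -(b y - c) + (b y - c') by ring]
        exact enorm_add_le _ _
    _ = ∫⁻ y in s, ‖b y - c‖ₑ ∂μ + ∫⁻ y in s, ‖b y - c'‖ₑ ∂μ :=
        lintegral_add_left' (hb.sub_const c).enorm.restrict _
    _ ≤ _ := by gcongr

section JohnNirenberg

open Filter Topology Module

variable {E : Type*} [NormedAddCommGroup E] [NormedSpace ℝ E] [FiniteDimensional ℝ E]
  [MeasurableSpace E] [BorelSpace E] (μ : Measure E) [μ.IsAddHaarMeasure]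

theorem addHaar_closedBall_smul (x y : E) {c t : ℝ} (hc : 0 ≤ c) (ht : 0 ≤ t) :
    μ (closedBall x (c * t)) = ENNReal.ofReal (c ^ finrank ℝ E) * μ (closedBall y t) := by
  rw [Measure.addHaar_closedBall_mul μ x hc ht, ← Measure.addHaar_closedBall_center μ y t]

/-- A Calderón–Zygmund type covering: outside a family of balls of small total measure the function
`u` is bounded by `Λ`, while its averages over these balls do not exceed `Λ`. -/
theorem exists_closedBall_cover_of_lt {u : E → ℝ≥0∞} (hu : AEMeasurable u μ) (z : E) {r : ℝ}
    (hr : 0 < r) {Λ : ℝ≥0∞} (hΛ : Λ ≠ 0) (hΛ' : Λ ≠ ∞)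
    (hint : 2 * 5 ^ finrank ℝ E * ∫⁻ y in closedBall z (2 * r), u y ∂μ ≤ Λ * μ (closedBall z r)) :
    ∃ (s : Set E) (ρ : E → ℝ), s.Countable ∧ (∀ x ∈ s, 0 < ρ x) ∧
      (∀ᵐ y ∂μ, y ∈ closedBall z r → Λ < u y → ∃ x ∈ s, y ∈ closedBall x (ρ x)) ∧
      (∀ x ∈ s, ∫⁻ y in closedBall x (ρ x), u y ∂μ ≤ Λ * μ (closedBall x (ρ x))) ∧
      ∑' x : s, μ (closedBall (x : E) (ρ x)) ≤ 2⁻¹ * μ (closedBall z r) := by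
  set d := finrank ℝ E
  have hd0 : (2 * 5 ^ d : ℝ≥0∞) ≠ 0 := by positivity
  have hdt : (2 * 5 ^ d : ℝ≥0∞) ≠ ∞ := by finiteness
  have hμfin (x : E) (t : ℝ) : μ (closedBall x t) ≠ ∞ := measure_closedBall_lt_top.ne
  have hfin : ∫⁻ y in closedBall z (2 * r), u y ∂μ ≠ ∞ := by
    intro h
    rw [h, ENNReal.mul_top hd0] at hint
    exact ENNReal.mul_ne_top hΛ' (hμfin z r) (top_le_iff.1 hint)
  set A : ℕ → ℝ := fun k ↦ r * (5⁻¹ : ℝ) ^ k with hA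
  have hApos (k : ℕ) : 0 < A k := by positivity
  have hAle (k : ℕ) : A k ≤ r := by
    simp only [hA]
    exact mul_le_of_le_one_right hr.le (pow_le_one₀ (by norm_num) (by norm_num))
  have hAsucc (k : ℕ) : 5 * A (k + 1) = A k := by simp only [hA, pow_succ]; ring
  have hsub {y : E} (hy : y ∈ closedBall z r) {t : ℝ} (ht : t ≤ r) :
      closedBall y t ⊆ closedBall z (2 * r) := by
    apply closedBall_subset_closedBall'
    rw [mem_closedBall] at hy
    linarith
  have hzero {y : E} (hy : y ∈ closedBall z r) :
      ∫⁻ w in closedBall y r, u w ∂μ ≤ Λ * μ (closedBall y r) := by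
    rw [Measure.addHaar_closedBall_center μ y, ← Measure.addHaar_closedBall_center μ z]
    refine le_trans ?_ hint
    refine (lintegral_mono_set (hsub hy le_rfl)).trans ?_
    refine le_mul_of_one_le_left' ?_
    exact one_le_mul (by norm_num) (one_le_pow₀ (by norm_num))
  let P : E → ℕ → Prop := fun y k ↦
    Λ * μ (closedBall y (A k)) < ∫⁻ w in closedBall y (A k), u w ∂μ
  let S : Set E := {y | y ∈ closedBall z r ∧ ∃ k, P y k}
  classical
  let K : E → ℕ := fun y ↦ if h : ∃ k, P y k then Nat.find h else 0
  have hK {y : E} (hy : y ∈ S) : P y (K y) := by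
    simp only [K, dif_pos hy.2]; exact Nat.find_spec hy.2
  have hK' {y : E} (hy : y ∈ S) {m : ℕ} (hm : m < K y) : ¬ P y m := by
    simp only [K, dif_pos hy.2] at hm; exact Nat.find_min hy.2 hm
  have hKpos {y : E} (hy : y ∈ S) : ∃ m, K y = m + 1 := by
    refine Nat.exists_eq_succ_of_ne_zero fun h0 ↦ ?_
    have := hK hy
    rw [h0] at this
    simp only [P, hA, pow_zero, mul_one] at this
    exact absurd (hzero hy.1) (not_le.2 this)
  obtain ⟨s, hsS, hdisj, hcov⟩ := Vitali.exists_disjoint_subfamily_covering_enlargement_closedBall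
    S (fun y ↦ y) (fun y ↦ A (K y)) r (fun y _ ↦ hAle _) 5 (by norm_num)
  have hscount : s.Countable := hdisj.countable_of_nonempty_interior fun y _ ↦
    ⟨y, ball_subset_interior_closedBall (mem_ball_self (hApos _))⟩
  refine ⟨s, fun y ↦ 5 * A (K y), hscount, fun y _ ↦ mul_pos (by norm_num) (hApos _), ?_, ?_, ?_⟩
  · have hv := (Besicovitch.vitaliFamily μ).ae_tendsto_lintegral_div
      (f := (closedBall z (2 * r)).indicator u) (hu.indicator measurableSet_closedBall)
      (by rwa [lintegral_indicator measurableSet_closedBall])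
    filter_upwards [hv] with y hy hyz hyΛ
    have hy' := hy.comp (Besicovitch.tendsto_filterAt μ y)
    have hAt : Tendsto A atTop (𝓝[>] 0) := by
      refine tendsto_nhdsWithin_iff.2 ⟨?_, Eventually.of_forall hApos⟩
      have := (tendsto_pow_atTop_nhds_zero_of_lt_one (r := (5⁻¹ : ℝ)) (by norm_num)
        (by norm_num)).const_mul r
      simpa [hA] using this
    have hy'' := hy'.comp hAt
    have hyz2 : y ∈ closedBall z (2 * r) := hsub hyz hr.le (mem_closedBall_self le_rfl)
    rw [Set.indicator_of_mem hyz2] at hy''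
    obtain ⟨k, hk⟩ := (hy''.eventually_const_lt hyΛ).exists
    have hPk : P y k := by
      simp only [Function.comp_apply] at hk
      rw [setLIntegral_indicator measurableSet_closedBall,
        Set.inter_eq_right.2 (hsub hyz (hAle k))] at hk
      exact (ENNReal.lt_div_iff_mul_lt (Or.inl (measure_closedBall_pos μ y (hApos k)).ne')
        (Or.inl (hμfin _ _))).1 hk
    obtain ⟨x, hx, hyx⟩ := hcov y ⟨hyz, k, hPk⟩
    exact ⟨x, hx, hyx (mem_closedBall_self (hApos _).le)⟩
  · intro y hy
    obtain ⟨m, hm⟩ := hKpos (hsS hy)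
    have := hK' (hsS hy) (m := m) (by omega)
    simp only [P, not_lt] at this
    simpa only [hm, hAsucc] using this
  · have h1 (y : s) : Λ * μ (closedBall (y : E) (5 * A (K y))) ≤
        5 ^ d * ∫⁻ w in closedBall (y : E) (A (K y)), u w ∂μ := by
      rw [addHaar_closedBall_smul μ (y : E) (y : E) (by norm_num) (hApos _).le,
        ENNReal.ofReal_pow (by norm_num), ENNReal.ofReal_ofNat, mul_left_comm]
      gcongr
      exact (hK (hsS y.2)).le
    have h2 : Λ * ∑' y : s, μ (closedBall (y : E) (5 * A (K y))) ≤
        Λ * (2⁻¹ * μ (closedBall z r)) := by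
      rw [← ENNReal.tsum_mul_left]
      calc _ ≤ ∑' y : s, 5 ^ d * ∫⁻ w in closedBall (y : E) (A (K y)), u w ∂μ :=
            ENNReal.tsum_le_tsum h1
        _ = 5 ^ d * ∫⁻ w in ⋃ y ∈ s, closedBall y (A (K y)), u w ∂μ := by
            rw [ENNReal.tsum_mul_left,
              lintegral_biUnion hscount (fun _ _ ↦ measurableSet_closedBall) hdisj]
        _ ≤ 5 ^ d * ∫⁻ w in closedBall z (2 * r), u w ∂μ := by
            gcongr
            exact Set.iUnion₂_subset fun y hy ↦ hsub (hsS hy).1 (hAle _)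
        _ = 2⁻¹ * (2 * 5 ^ d * ∫⁻ w in closedBall z (2 * r), u w ∂μ) := by
            rw [mul_assoc, ← mul_assoc, ENNReal.inv_mul_cancel (by norm_num) (by norm_num), one_mul]
        _ ≤ 2⁻¹ * (Λ * μ (closedBall z r)) := by gcongr
        _ = _ := by rw [mul_left_comm]
    rwa [ENNReal.mul_le_mul_iff_right hΛ hΛ'] at h2

/-- The John–Nirenberg inequality on balls, at integer multiples of a fixed level. -/
theorem measure_lt_enorm_sub_le {b : E → ℝ} (hb : AEMeasurable b μ) (c : E → ℝ → ℝ) {N : ℝ≥0∞}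
    (hN : N ≠ 0) (hN' : N ≠ ∞)
    (hosc : ∀ x r, 0 < r → ∫⁻ y in closedBall x r, ‖b y - c x r‖ₑ ∂μ ≤ N * μ (closedBall x r))
    (k : ℕ) (z : E) {r : ℝ} (hr : 0 < r) :
    μ {y ∈ closedBall z r |
        k * ((1 + 2 * 10 ^ finrank ℝ E * (2 + 2 ^ finrank ℝ E)) * N) < ‖b y - c z r‖ₑ} ≤
      2⁻¹ ^ k * μ (closedBall z r) := by
  set d := finrank ℝ E
  induction k generalizing z r with
  | zero =>
    simp only [pow_zero, one_mul]
    exact measure_mono (Set.sep_subset _ _)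
  | succ k ih =>
    set Λ : ℝ≥0∞ := 2 * 10 ^ d * (2 + 2 ^ d) * N with hΛ
    have hsplit : (1 + 2 * 10 ^ d * (2 + 2 ^ d)) * N = N + Λ := by rw [add_mul, one_mul]
    rw [hsplit] at ih ⊢
    have hΛ0 : Λ ≠ 0 := by
      have : (2 * 10 ^ d * (2 + 2 ^ d) : ℝ≥0∞) ≠ 0 := by positivity
      exact mul_ne_zero this hN
    have hΛt : Λ ≠ ∞ := by finiteness
    have hμfin (x : E) (t : ℝ) : μ (closedBall x t) ≠ ∞ := measure_closedBall_lt_top.ne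
    have hμpos {x : E} {t : ℝ} (ht : 0 < t) : μ (closedBall x t) ≠ 0 :=
      (measure_closedBall_pos μ x ht).ne'
    have hdouble : μ (closedBall z (2 * r)) = 2 ^ d * μ (closedBall z r) := by
      rw [addHaar_closedBall_smul μ z z (by norm_num) hr.le, ENNReal.ofReal_pow (by norm_num),
        ENNReal.ofReal_ofNat]
    have hsub : closedBall z r ⊆ closedBall z (2 * r) := closedBall_subset_closedBall (by linarith)
    have hdiff : ‖c z r - c z (2 * r)‖ₑ ≤ (1 + 2 ^ d) * N := by
      refine (ENNReal.mul_le_mul_iff_left (hμpos hr) (hμfin z r)).1 ?_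
      refine (enorm_sub_mul_measure_le μ hb _ _ hsub).trans ?_
      refine (add_le_add (hosc z r hr) (hosc z (2 * r) (by linarith))).trans_eq ?_
      rw [hdouble]; ring
    have hint : 2 * 5 ^ d * ∫⁻ y in closedBall z (2 * r), ‖b y - c z r‖ₑ ∂μ ≤
        Λ * μ (closedBall z r) := by
      have : ∫⁻ y in closedBall z (2 * r), ‖b y - c z r‖ₑ ∂μ ≤
          N * μ (closedBall z (2 * r)) + (1 + 2 ^ d) * N * μ (closedBall z (2 * r)) := by
        calc _ ≤ ∫⁻ y in closedBall z (2 * r), (‖b y - c z (2 * r)‖ₑ + (1 + 2 ^ d) * N) ∂μ := by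
              refine lintegral_mono fun y ↦ ?_
              refine le_trans ?_ (add_le_add le_rfl hdiff)
              rw [← enorm_neg (c z r - c z (2 * r)),
                show b y - c z r = (b y - c z (2 * r)) + -(c z r - c z (2 * r)) by ring]
              exact enorm_add_le _ _
          _ = ∫⁻ y in closedBall z (2 * r), ‖b y - c z (2 * r)‖ₑ ∂μ +
                (1 + 2 ^ d) * N * μ (closedBall z (2 * r)) := by
              rw [lintegral_add_right _ measurable_const, lintegral_const,
                Measure.restrict_apply_univ]
          _ ≤ _ := by gcongr; exact hosc z (2 * r) (by linarith)
      refine (mul_le_mul_right this _).trans_eq ?_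
      rw [hdouble, hΛ, show (10 : ℝ≥0∞) = 5 * 2 by norm_num, mul_pow]
      ring
    obtain ⟨s, ρ, hs, hρ, hcov, havg, hsum⟩ := exists_closedBall_cover_of_lt μ
      (hb.sub_const (c z r)).enorm z hr hΛ0 hΛt hint
    have hcj {x : E} (hx : x ∈ s) : ‖c x (ρ x) - c z r‖ₑ ≤ N + Λ := by
      refine (ENNReal.mul_le_mul_iff_left (hμpos (hρ x hx)) (hμfin x _)).1 ?_
      refine (enorm_sub_mul_measure_le μ hb _ _ le_rfl).trans ?_
      refine (add_le_add (hosc x _ (hρ x hx)) (havg x hx)).trans_eq ?_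
      rw [add_mul]
    calc μ {y ∈ closedBall z r | (k + 1 : ℕ) * (N + Λ) < ‖b y - c z r‖ₑ}
        ≤ μ (⋃ x ∈ s, {y ∈ closedBall x (ρ x) | k * (N + Λ) < ‖b y - c x (ρ x)‖ₑ}) := by
          refine measure_mono_ae ?_
          filter_upwards [hcov] with y hy hyS
          obtain ⟨hyz, hyk⟩ := hyS
          have h1 : Λ ≤ ((k + 1 : ℕ) : ℝ≥0∞) * (N + Λ) :=
            le_add_self.trans (le_mul_of_one_le_left' (by exact_mod_cast Nat.succ_pos k))
          obtain ⟨x, hx, hyx⟩ := hy hyz (h1.trans_lt hyk)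
          refine Set.mem_iUnion₂.2 ⟨x, hx, hyx, ?_⟩
          by_contra hcon
          rw [not_lt] at hcon
          refine absurd hyk (not_lt.2 ?_)
          rw [show b y - c z r = (b y - c x (ρ x)) + (c x (ρ x) - c z r) by ring]
          refine (enorm_add_le _ _).trans ((add_le_add hcon (hcj hx)).trans_eq ?_)
          push_cast; ring
      _ ≤ ∑' x : s, μ {y ∈ closedBall (x : E) (ρ x) | k * (N + Λ) < ‖b y - c x (ρ x)‖ₑ} :=
          measure_biUnion_le μ hs _
      _ ≤ ∑' x : s, 2⁻¹ ^ k * μ (closedBall (x : E) (ρ x)) :=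
          ENNReal.tsum_le_tsum fun x ↦ ih x (hρ x x.2)
      _ ≤ 2⁻¹ ^ k * (2⁻¹ * μ (closedBall z r)) := by
          rw [ENNReal.tsum_mul_left]; gcongr
      _ = _ := by rw [pow_succ, mul_assoc]

theorem tsum_geometric_half_mul_rpow_ne_top (s : ℝ) :
    ∑' k : ℕ, (2⁻¹ : ℝ≥0∞) ^ k * ENNReal.ofReal (((k : ℝ) + 1) ^ s) ≠ ∞ := by
  have hsum : Summable fun k : ℕ ↦ (2⁻¹ : ℝ) ^ k * ((k : ℝ) + 1) ^ s := by
    obtain ⟨m, hm⟩ := exists_nat_ge s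
    have h := (summable_pow_mul_geometric_of_norm_lt_one m (r := (2⁻¹ : ℝ)) (by norm_num))
    have h' := ((summable_nat_add_iff 1).2 h).mul_left 2
    refine Summable.of_nonneg_of_le (fun k ↦ by positivity) (fun k ↦ ?_) h'
    have h1 : ((k : ℝ) + 1) ^ s ≤ ((k : ℝ) + 1) ^ m := by
      rw [← Real.rpow_natCast]
      exact Real.rpow_le_rpow_of_exponent_le (by linarith [k.cast_nonneg (α := ℝ)]) hm
    calc (2⁻¹ : ℝ) ^ k * ((k : ℝ) + 1) ^ s ≤ (2⁻¹ : ℝ) ^ k * ((k : ℝ) + 1) ^ m := by gcongr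
      _ = _ := by push_cast; rw [pow_succ]; ring
  have h := hsum.tsum_ofReal_ne_top
  convert! h using 4 with k
  rw [ENNReal.ofReal_mul (by positivity), ENNReal.ofReal_pow (by positivity),
    ENNReal.ofReal_inv_of_pos (by norm_num), ENNReal.ofReal_ofNat]

/-- The John–Nirenberg inequality on balls: mean oscillation controls `L^s` oscillation. -/
theorem exists_lintegral_enorm_sub_rpow_le {s : ℝ} (hs : 0 < s) :
    ∃ C : ℝ≥0∞, C ≠ ∞ ∧ ∀ (b : E → ℝ) (c : E → ℝ → ℝ) (N : ℝ≥0∞), AEMeasurable b μ → N ≠ ∞ →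
      (∀ x r, 0 < r → ∫⁻ y in closedBall x r, ‖b y - c x r‖ₑ ∂μ ≤ N * μ (closedBall x r)) →
      ∀ (z : E) (r : ℝ), 0 < r →
        ∫⁻ y in closedBall z r, ‖b y - c z r‖ₑ ^ s ∂μ ≤ C * N ^ s * μ (closedBall z r) := by
  set A : ℝ≥0∞ := 1 + 2 * 10 ^ finrank ℝ E * (2 + 2 ^ finrank ℝ E)
  have hA1 : 1 ≤ A := le_self_add
  have hAt : A ≠ ∞ := by finiteness
  refine ⟨A ^ s * ∑' k : ℕ, (2⁻¹ : ℝ≥0∞) ^ k * ENNReal.ofReal (((k : ℝ) + 1) ^ s),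
    ENNReal.mul_ne_top (ENNReal.rpow_ne_top_of_nonneg hs.le hAt)
      (tsum_geometric_half_mul_rpow_ne_top s), fun b c N hb hN hosc z r hr ↦ ?_⟩
  have hmeas : AEMeasurable (fun y ↦ ‖b y - c z r‖ₑ) μ := (hb.sub_const _).enorm
  rcases eq_or_ne N 0 with rfl | hN0
  · have h0 : ∫⁻ y in closedBall z r, ‖b y - c z r‖ₑ ∂μ = 0 := by
      simpa using hosc z r hr
    rw [lintegral_eq_zero_iff' hmeas.restrict] at h0
    have : ∫⁻ y in closedBall z r, ‖b y - c z r‖ₑ ^ s ∂μ = 0 := by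
      rw [lintegral_eq_zero_iff' (hmeas.pow_const s).restrict]
      filter_upwards [h0] with y hy
      simp only [Pi.zero_apply] at hy ⊢
      rw [hy, ENNReal.zero_rpow_of_pos hs]
    simp [this]
  set T : ℝ≥0∞ := A * N
  have hT0 : T ≠ 0 := mul_ne_zero (by positivity) hN0
  have hTt : T ≠ ∞ := ENNReal.mul_ne_top hAt hN
  have hpt (t : ℝ≥0∞) (ht : t ≠ ∞) :
      t ^ s ≤ ∑' k : ℕ, (Set.Ioi ((k : ℝ≥0∞) * T)).indicator
        (fun _ ↦ (((k : ℝ≥0∞) + 1) * T) ^ s) t := by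
    rcases eq_or_ne t 0 with rfl | ht0
    · simp [ENNReal.zero_rpow_of_pos hs]
    have hex : ∃ m : ℕ, t ≤ m * T := by
      obtain ⟨m, hm⟩ := ENNReal.exists_nat_gt (ENNReal.div_ne_top ht hT0)
      exact ⟨m, (ENNReal.div_le_iff_le_mul (Or.inl hT0) (Or.inl hTt)).1 hm.le⟩
    classical
    have hpos : Nat.find hex ≠ 0 := by
      intro h0
      have := Nat.find_spec hex
      rw [h0] at this
      simp [ht0] at this
    obtain ⟨k, hk⟩ := Nat.exists_eq_succ_of_ne_zero hpos
    have h1 : (k : ℝ≥0∞) * T < t := not_le.1 (Nat.find_min hex (m := k) (by omega))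
    have h2 : t ≤ ((k : ℝ≥0∞) + 1) * T := by
      have := Nat.find_spec hex
      rw [hk] at this
      exact_mod_cast this
    refine le_trans ?_ (ENNReal.le_tsum k)
    rw [Set.indicator_of_mem (Set.mem_Ioi.2 h1)]
    gcongr
  have hset (k : ℕ) : NullMeasurableSet {y | (k : ℝ≥0∞) * T < ‖b y - c z r‖ₑ}
      (μ.restrict (closedBall z r)) := nullMeasurableSet_lt aemeasurable_const hmeas.restrict
  calc ∫⁻ y in closedBall z r, ‖b y - c z r‖ₑ ^ s ∂μ
      ≤ ∫⁻ y in closedBall z r, ∑' k : ℕ, {y | (k : ℝ≥0∞) * T < ‖b y - c z r‖ₑ}.indicator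
          (fun _ ↦ (((k : ℝ≥0∞) + 1) * T) ^ s) y ∂μ :=
        lintegral_mono fun y ↦ hpt _ enorm_ne_top
    _ = ∑' k : ℕ, ∫⁻ y in closedBall z r, {y | (k : ℝ≥0∞) * T < ‖b y - c z r‖ₑ}.indicator
          (fun _ ↦ (((k : ℝ≥0∞) + 1) * T) ^ s) y ∂μ :=
        lintegral_tsum fun k ↦ aemeasurable_const.indicator₀ (hset k)
    _ ≤ ∑' k : ℕ, (((k : ℝ≥0∞) + 1) * T) ^ s * (2⁻¹ ^ k * μ (closedBall z r)) := by
        refine ENNReal.tsum_le_tsum fun k ↦ ?_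
        rw [lintegral_indicator_const₀ (hset k),
          Measure.restrict_apply₀ (hset k), Set.inter_comm]
        gcongr
        exact measure_lt_enorm_sub_le μ hb c hN0 hN hosc k z hr
    _ = _ := by
        rw [← ENNReal.tsum_mul_left, ← ENNReal.tsum_mul_right, ← ENNReal.tsum_mul_right]
        refine tsum_congr fun k ↦ ?_
        rw [ENNReal.mul_rpow_of_nonneg _ _ hs.le, ENNReal.mul_rpow_of_nonneg _ _ hs.le,
          ← ENNReal.ofReal_rpow_of_nonneg (by positivity) hs.le,
          ENNReal.ofReal_add (by positivity) zero_le_one, ENNReal.ofReal_natCast, ENNReal.ofReal_one]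
        ring

end JohnNirenberg

section Cube

open Filter Topology

variable {n : ℕ}

theorem cube_eq_preimage (z : EuclideanSpace ℝ (Fin n)) {r : ℝ} (hr : 0 ≤ r) :
    cube z r = WithLp.ofLp ⁻¹' closedBall (WithLp.ofLp z) (r / 2) := by
  ext y
  simp [cube, dist_pi_le_iff (by linarith : 0 ≤ r / 2), Real.dist_eq]

theorem measurableSet_cube (z : EuclideanSpace ℝ (Fin n)) {r : ℝ} (hr : 0 ≤ r) :
    MeasurableSet (cube z r) := by
  rw [cube_eq_preimage z hr]
  exact (PiLp.volume_preserving_ofLp (Fin n)).measurable measurableSet_closedBall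

theorem volume_cube (z : EuclideanSpace ℝ (Fin n)) {r : ℝ} (hr : 0 ≤ r) :
    volume (cube z r) = ENNReal.ofReal (r ^ (n : ℝ)) := by
  rw [cube_eq_preimage z hr, (PiLp.volume_preserving_ofLp (Fin n)).measure_preimage
    measurableSet_closedBall.nullMeasurableSet, Real.volume_pi_closedBall _ (by linarith),
    Fintype.card_fin, mul_div_cancel₀ _ (by norm_num), Real.rpow_natCast]

theorem volume_cube_ne_zero (z : EuclideanSpace ℝ (Fin n)) {r : ℝ} (hr : 0 < r) :
    volume (cube z r) ≠ 0 := by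
  rw [volume_cube z hr.le]
  exact (ENNReal.ofReal_pos.2 (Real.rpow_pos_of_pos hr _)).ne'

theorem volume_cube_ne_top (z : EuclideanSpace ℝ (Fin n)) {r : ℝ} (hr : 0 ≤ r) :
    volume (cube z r) ≠ ∞ := by
  rw [volume_cube z hr]
  exact ENNReal.ofReal_ne_top

theorem volume_cube_mul (z : EuclideanSpace ℝ (Fin n)) {c r : ℝ} (hc : 0 ≤ c) (hr : 0 ≤ r) :
    volume (cube z (c * r)) = ENNReal.ofReal c ^ n * volume (cube z r) := by
  rw [volume_cube z hr, volume_cube z (mul_nonneg hc hr), Real.mul_rpow hc hr,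
    ENNReal.ofReal_mul (by positivity), Real.rpow_natCast c, ENNReal.ofReal_pow hc]

theorem cube_subset_cube (z : EuclideanSpace ℝ (Fin n)) {r r' : ℝ} (h : r ≤ r') :
    cube z r ⊆ cube z r' := fun _ hy i ↦ (hy i).trans (by linarith)

theorem closedBall_subset_cube (z : EuclideanSpace ℝ (Fin n)) (r : ℝ) :
    closedBall z r ⊆ cube z (2 * r) := by
  intro y hy i
  rw [mem_closedBall, dist_eq_norm] at hy
  have := (PiLp.norm_apply_le (y - z) i).trans hy
  simp only [PiLp.sub_apply, Real.norm_eq_abs] at this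
  linarith

theorem half_lt_norm_sub {y z : EuclideanSpace ℝ (Fin n)} {r : ℝ} (hy : y ∉ cube z r) :
    r / 2 < ‖y - z‖ := by
  by_contra! h
  refine hy ?_
  have := closedBall_subset_cube z (r / 2) (by rwa [mem_closedBall, dist_eq_norm])
  rwa [mul_div_cancel₀ _ (by norm_num)] at this

theorem norm_sub_le_of_mem_cube {y z : EuclideanSpace ℝ (Fin n)} {r : ℝ} (hr : 0 ≤ r)
    (hy : y ∈ cube z r) : ‖y - z‖ ≤ n * (r / 2) := by
  rw [EuclideanSpace.norm_eq]
  refine Real.sqrt_le_iff.2 ⟨by positivity, ?_⟩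
  have h1 : ∑ i, ‖(y - z) i‖ ^ 2 ≤ ∑ _i : Fin n, (r / 2) ^ 2 := by
    refine Finset.sum_le_sum fun i _ ↦ ?_
    have := hy i
    simp only [PiLp.sub_apply, Real.norm_eq_abs]
    gcongr
  refine h1.trans ?_
  simp only [Finset.sum_const, Finset.card_univ, Fintype.card_fin, nsmul_eq_mul, mul_pow]
  gcongr
  exact_mod_cast Nat.le_self_pow (by norm_num) n

theorem lintegral_cube_enorm_sub_setAvg_le (b : EuclideanSpace ℝ (Fin n) → ℝ)
    (z : EuclideanSpace ℝ (Fin n)) {r : ℝ} (hr : 0 < r) :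
    ∫⁻ y in cube z r, ‖b y - setAvg (cube z r) b‖ₑ ≤ bmoNorm b * volume (cube z r) := by
  have h : (volume (cube z r))⁻¹ * ∫⁻ y in cube z r, ENNReal.ofReal |b y - setAvg (cube z r) b| ≤
      bmoNorm b := le_iSup_of_le z (le_iSup_of_le r (le_iSup_of_le hr le_rfl))
  simp_rw [Real.enorm_eq_ofReal_abs]
  rw [mul_comm]
  exact (ENNReal.inv_mul_le_iff (volume_cube_ne_zero z hr) (volume_cube_ne_top z hr.le)).1 h

/-- The `L^s` form of the John–Nirenberg inequality for cubes; the average is taken over a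
concentric dilated cube. -/
theorem exists_lintegral_cube_enorm_sub_rpow_le (hn : 1 ≤ n) {s : ℝ} (hs : 0 < s) :
    ∃ C : ℝ≥0∞, C ≠ ∞ ∧ ∀ b : EuclideanSpace ℝ (Fin n) → ℝ, MemBMO b →
      ∀ (z : EuclideanSpace ℝ (Fin n)) (r : ℝ), 0 < r →
        ∫⁻ y in cube z r, ‖b y - setAvg (cube z (2 * (n * r))) b‖ₑ ^ s ≤
          C * bmoNorm b ^ s * volume (cube z r) := by
  obtain ⟨C, hC, h⟩ := exists_lintegral_enorm_sub_rpow_le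
    (volume : Measure (EuclideanSpace ℝ (Fin n))) hs
  set ω : ℝ≥0∞ := volume (ball (0 : EuclideanSpace ℝ (Fin n)) 1) with hω
  have hω0 : ω ≠ 0 := (measure_ball_pos _ _ one_pos).ne'
  have hωt : ω ≠ ∞ := measure_ball_lt_top.ne
  have hn0 : (0 : ℝ) < n := by exact_mod_cast hn
  have hball (x : EuclideanSpace ℝ (Fin n)) {t : ℝ} (ht : 0 ≤ t) :
      volume (closedBall x t) = ω * volume (cube x t) := by
    rw [Measure.addHaar_closedBall _ _ ht, volume_cube x ht, finrank_euclideanSpace_fin,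
      mul_comm, Real.rpow_natCast]
  refine ⟨C * (2 ^ n * ω⁻¹) ^ s * (ω * n ^ n), ?_, fun b hb z r hr ↦ ?_⟩
  · have := ENNReal.rpow_ne_top_of_nonneg hs.le
      (ENNReal.mul_ne_top (by finiteness) (ENNReal.inv_ne_top.2 hω0) : 2 ^ n * ω⁻¹ ≠ ∞)
    finiteness
  have hosc : ∀ (x : EuclideanSpace ℝ (Fin n)) (t : ℝ), 0 < t →
      ∫⁻ y in closedBall x t, ‖b y - setAvg (cube x (2 * t)) b‖ₑ ≤
        (2 ^ n * ω⁻¹ * bmoNorm b) * volume (closedBall x t) := by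
    intro x t ht
    calc _ ≤ ∫⁻ y in cube x (2 * t), ‖b y - setAvg (cube x (2 * t)) b‖ₑ :=
          lintegral_mono_set (closedBall_subset_cube x t)
      _ ≤ bmoNorm b * volume (cube x (2 * t)) :=
          lintegral_cube_enorm_sub_setAvg_le b x (by linarith)
      _ = _ := by
          rw [volume_cube_mul x (by norm_num) ht.le, hball x ht.le, ENNReal.ofReal_ofNat]
          calc _ = 2 ^ n * bmoNorm b * volume (cube x t) * 1 := by ring
            _ = _ := by rw [← ENNReal.inv_mul_cancel hω0 hωt]; ring
  have hN : 2 ^ n * ω⁻¹ * bmoNorm b ≠ ∞ :=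
    ENNReal.mul_ne_top (ENNReal.mul_ne_top (by finiteness) (ENNReal.inv_ne_top.2 hω0)) hb.2
  have hnr : 0 < n * r := by positivity
  have hsub : cube z r ⊆ closedBall z (n * r) := fun y hy ↦ by
    rw [mem_closedBall, dist_eq_norm]
    refine (norm_sub_le_of_mem_cube hr.le hy).trans ?_
    gcongr
    linarith
  refine (lintegral_mono_set hsub).trans ?_
  refine (h b (fun x t ↦ setAvg (cube x (2 * t)) b) _
    hb.1.aestronglyMeasurable.aemeasurable hN hosc z _ hnr).trans_eq ?_
  rw [hball z hnr.le, volume_cube_mul z hn0.le hr.le, ENNReal.mul_rpow_of_nonneg _ _ hs.le,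
    ENNReal.ofReal_natCast]
  ring

theorem enorm_setAvg_sub_setAvg_le {b : EuclideanSpace ℝ (Fin n) → ℝ} (hb : AEMeasurable b)
    (z : EuclideanSpace ℝ (Fin n)) {r : ℝ} (hr : 0 < r) :
    ‖setAvg (cube z (2 * r)) b - setAvg (cube z r) b‖ₑ ≤ (1 + 2 ^ n) * bmoNorm b := by
  rw [← enorm_neg, neg_sub]
  refine (ENNReal.mul_le_mul_iff_left (volume_cube_ne_zero z hr)
    (volume_cube_ne_top z hr.le)).1 ?_
  refine (enorm_sub_mul_measure_le volume hb _ _ (cube_subset_cube z (by linarith : r ≤ 2 * r))).trans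
    ?_
  refine (add_le_add (lintegral_cube_enorm_sub_setAvg_le b z hr)
    (lintegral_cube_enorm_sub_setAvg_le b z (by linarith))).trans_eq ?_
  rw [volume_cube_mul z (by norm_num) hr.le, ENNReal.ofReal_ofNat]
  ring

theorem enorm_setAvg_pow_sub_setAvg_le {b : EuclideanSpace ℝ (Fin n) → ℝ} (hb : AEMeasurable b)
    (z : EuclideanSpace ℝ (Fin n)) {r : ℝ} (hr : 0 < r) (k : ℕ) :
    ‖setAvg (cube z (2 ^ k * r)) b - setAvg (cube z r) b‖ₑ ≤ k * ((1 + 2 ^ n) * bmoNorm b) := by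
  induction k with
  | zero => simp
  | succ k ih =>
    rw [← sub_add_sub_cancel _ (setAvg (cube z (2 ^ k * r)) b), pow_succ', mul_assoc]
    refine (enorm_add_le _ _).trans ?_
    refine (add_le_add (enorm_setAvg_sub_setAvg_le hb z (by positivity)) ih).trans_eq ?_
    push_cast; ring

/-- `L^s` oscillation of a BMO function over dyadic dilates of a cube grows at most linearly. -/
theorem exists_lintegral_cube_pow_enorm_sub_rpow_le (hn : 1 ≤ n) {s : ℝ} (hs : 1 ≤ s) :
    ∃ C : ℝ≥0∞, C ≠ ∞ ∧ ∀ b : EuclideanSpace ℝ (Fin n) → ℝ, MemBMO b →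
      ∀ (z : EuclideanSpace ℝ (Fin n)) (r : ℝ), 0 < r → ∀ k : ℕ,
        (∫⁻ y in cube z (2 ^ k * r), ‖b y - setAvg (cube z (2 * (n * r))) b‖ₑ ^ s) ^ (1 / s) ≤
          C * bmoNorm b * (k + 1) * volume (cube z (2 ^ k * r)) ^ (1 / s) := by
  have hs0 : 0 < s := by linarith
  have hs1 : 0 ≤ 1 / s := by positivity
  obtain ⟨C, hC, h⟩ := exists_lintegral_cube_enorm_sub_rpow_le hn hs0
  refine ⟨C ^ (1 / s) + (1 + 2 ^ n), ?_, fun b hb z r hr k ↦ ?_⟩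
  · have := ENNReal.rpow_ne_top_of_nonneg hs1 hC
    finiteness
  have hbm : AEMeasurable b := hb.1.aestronglyMeasurable.aemeasurable
  have hn0 : (0 : ℝ) < n := by exact_mod_cast hn
  set Q := cube z (2 ^ k * r)
  set c := setAvg (cube z (2 * (n * r))) b
  set c' := setAvg (cube z (2 * (n * (2 ^ k * r)))) b with hc'
  have hcc : ‖c' - c‖ₑ ≤ k * ((1 + 2 ^ n) * bmoNorm b) := by
    rw [hc', show 2 * (n * (2 ^ k * r)) = 2 ^ k * (2 * (n * r)) by ring]
    exact enorm_setAvg_pow_sub_setAvg_le hbm z (by positivity) k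
  calc (∫⁻ y in Q, ‖b y - c‖ₑ ^ s) ^ (1 / s)
      ≤ (∫⁻ y in Q, (‖b y - c'‖ₑ + ‖c' - c‖ₑ) ^ s) ^ (1 / s) := by
        gcongr with y
        rw [← sub_add_sub_cancel (b y) c' c]
        exact enorm_add_le _ _
    _ ≤ (∫⁻ y in Q, ‖b y - c'‖ₑ ^ s) ^ (1 / s) + (∫⁻ _ in Q, ‖c' - c‖ₑ ^ s) ^ (1 / s) :=
        ENNReal.lintegral_Lp_add_le (hbm.sub_const _).enorm.restrict aemeasurable_const hs
    _ ≤ (C * bmoNorm b ^ s * volume Q) ^ (1 / s) +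
          k * ((1 + 2 ^ n) * bmoNorm b) * volume Q ^ (1 / s) := by
        rw [lintegral_const, Measure.restrict_apply_univ, ENNReal.mul_rpow_of_nonneg _ _ hs1,
          ← ENNReal.rpow_mul, mul_one_div_cancel hs0.ne', ENNReal.rpow_one]
        gcongr
        exact h b hb z _ (by positivity)
    _ = (C ^ (1 / s) * 1 + (1 + 2 ^ n) * k) * bmoNorm b * volume Q ^ (1 / s) := by
        rw [ENNReal.mul_rpow_of_nonneg _ _ hs1, ENNReal.mul_rpow_of_nonneg _ _ hs1,
          ← ENNReal.rpow_mul, mul_one_div_cancel hs0.ne', ENNReal.rpow_one]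
        ring
    _ ≤ (C ^ (1 / s) * (k + 1) + (1 + 2 ^ n) * (k + 1)) * bmoNorm b * volume Q ^ (1 / s) := by
        gcongr
        · exact le_add_self
        · exact le_self_add
    _ = _ := by ring

/-- Hölder's inequality for the product of a BMO oscillation and a function. -/
theorem exists_lintegral_cube_pow_enorm_sub_mul_le (hn : 1 ≤ n) {η : ℝ} (hη : 1 < η) :
    ∃ C : ℝ≥0∞, C ≠ ∞ ∧ ∀ b : EuclideanSpace ℝ (Fin n) → ℝ, MemBMO b →
      ∀ g : EuclideanSpace ℝ (Fin n) → ℝ≥0∞, AEMeasurable g →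
      ∀ (z : EuclideanSpace ℝ (Fin n)) (r : ℝ), 0 < r → ∀ k : ℕ,
        ∫⁻ y in cube z (2 ^ k * r), ‖b y - setAvg (cube z (2 * (n * r))) b‖ₑ * g y ≤
          C * bmoNorm b * (k + 1) * volume (cube z (2 ^ k * r)) ^ (1 - 1 / η) *
            (∫⁻ y in cube z (2 ^ k * r), g y ^ η) ^ (1 / η) := by
  have hc : η.HolderConjugate (Real.conjExponent η) := Real.HolderConjugate.conjExponent hη
  have hc' := hc.symm
  obtain ⟨C, hC, h⟩ := exists_lintegral_cube_pow_enorm_sub_rpow_le hn hc'.lt.le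
  refine ⟨C, hC, fun b hb g hg z r hr k ↦ ?_⟩
  have hbm : AEMeasurable b := hb.1.aestronglyMeasurable.aemeasurable
  refine (ENNReal.lintegral_mul_le_Lp_mul_Lq (volume.restrict (cube z (2 ^ k * r))) hc'
    (hbm.sub_const _).enorm.restrict hg.restrict).trans ?_
  have he : 1 - 1 / η = 1 / Real.conjExponent η := by
    have := hc.inv_add_inv_eq_one
    rw [one_div, one_div]; linarith
  rw [he]
  gcongr
  exact h b hb z r hr k

end Cube

section Kernel

open Filter Topology

variable {n : ℕ}

/-- A function whose integrals over dyadic dilates of a cube grow like `(k + 1) (2 ^ k r) ^ d` is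
integrable away from the cube against the kernel `‖y - z‖ ^ e`, if `e + d < 0`. -/
theorem exists_lintegral_compl_cube_rpow_mul_le (n : ℕ) {e d : ℝ} (he : e ≤ 0)
    (hed : e + d < 0) :
    ∃ C : ℝ≥0∞, C ≠ ∞ ∧ ∀ (h : EuclideanSpace ℝ (Fin n) → ℝ≥0∞) (B : ℝ≥0∞)
      (z : EuclideanSpace ℝ (Fin n)) (r : ℝ), 0 < r →
      (∀ k : ℕ, ∫⁻ y in cube z (2 ^ k * r), h y ≤
        B * (k + 1) * ENNReal.ofReal ((2 ^ k * r) ^ d)) →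
      ∫⁻ y in (cube z r)ᶜ, ENNReal.ofReal (‖y - z‖ ^ e) * h y ≤
        C * B * ENNReal.ofReal (r ^ (e + d)) := by
  set a : ℕ → ℝ := fun k ↦ (2 : ℝ) ^ (d - e) * (((k : ℝ) + 2) * ((2 : ℝ) ^ (e + d)) ^ k) with ha
  have hρ : (2 : ℝ) ^ (e + d) < 1 := Real.rpow_lt_one_of_one_lt_of_neg (by norm_num) hed
  have hρ0 : (0 : ℝ) < (2 : ℝ) ^ (e + d) := by positivity
  have hsum : Summable a := by
    refine Summable.mul_left _ ?_
    have h1 := summable_pow_mul_geometric_of_norm_lt_one 1 (r := (2 : ℝ) ^ (e + d))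
      (by rwa [Real.norm_eq_abs, abs_of_pos hρ0])
    have h2 := (summable_geometric_of_lt_one hρ0.le hρ).mul_left 2
    refine (h1.add h2).congr fun k ↦ ?_
    ring
  refine ⟨∑' k, ENNReal.ofReal (a k), hsum.tsum_ofReal_ne_top, fun h B z r hr hB ↦ ?_⟩
  have hcov : (cube z r)ᶜ ⊆ ⋃ k : ℕ, cube z (2 ^ (k + 1) * r) \ cube z (2 ^ k * r) := by
    intro y hy
    have hex : ∃ k : ℕ, y ∈ cube z (2 ^ k * r) := by
      obtain ⟨k, hk⟩ := pow_unbounded_of_one_lt (2 * ‖y - z‖ / r) (by norm_num : (1 : ℝ) < 2)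
      refine ⟨k, ?_⟩
      by_contra hcon
      have := half_lt_norm_sub hcon
      rw [div_lt_iff₀ hr] at hk
      linarith
    classical
    have hpos : Nat.find hex ≠ 0 := by
      intro h0
      have := Nat.find_spec hex
      rw [h0, pow_zero, one_mul] at this
      exact hy this
    obtain ⟨k, hk⟩ := Nat.exists_eq_succ_of_ne_zero hpos
    refine Set.mem_iUnion.2 ⟨k, ?_, Nat.find_min hex (m := k) (by omega)⟩
    have := Nat.find_spec hex
    rwa [hk] at this
  have hterm (k : ℕ) : ∫⁻ y in cube z (2 ^ (k + 1) * r) \ cube z (2 ^ k * r),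
      ENNReal.ofReal (‖y - z‖ ^ e) * h y ≤
        ENNReal.ofReal (a k) * (B * ENNReal.ofReal (r ^ (e + d))) := by
    have hkr : 0 < 2 ^ k * r / 2 := by positivity
    calc ∫⁻ y in cube z (2 ^ (k + 1) * r) \ cube z (2 ^ k * r), ENNReal.ofReal (‖y - z‖ ^ e) * h y
        ≤ ∫⁻ y in cube z (2 ^ (k + 1) * r) \ cube z (2 ^ k * r),
            ENNReal.ofReal ((2 ^ k * r / 2) ^ e) * h y := by
          refine setLIntegral_mono' ((measurableSet_cube z (by positivity)).diff
            (measurableSet_cube z (by positivity))) fun y hy ↦ ?_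
          exact mul_le_mul_left (ENNReal.ofReal_le_ofReal
            (Real.rpow_le_rpow_of_nonpos hkr (half_lt_norm_sub hy.2).le he)) _
      _ = ENNReal.ofReal ((2 ^ k * r / 2) ^ e) *
            ∫⁻ y in cube z (2 ^ (k + 1) * r) \ cube z (2 ^ k * r), h y :=
          lintegral_const_mul' _ _ ENNReal.ofReal_ne_top
      _ ≤ ENNReal.ofReal ((2 ^ k * r / 2) ^ e) *
            (B * ((k + 1 : ℕ) + 1) * ENNReal.ofReal ((2 ^ (k + 1) * r) ^ d)) := by
          gcongr
          exact (lintegral_mono_set Set.sdiff_subset).trans (hB (k + 1))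
      _ = _ := by
          have h2 : (((k + 1 : ℕ) : ℝ≥0∞) + 1) = ENNReal.ofReal ((k : ℝ) + 2) := by
            rw [ENNReal.ofReal_add (by positivity) (by norm_num), ENNReal.ofReal_natCast,
              ENNReal.ofReal_ofNat]
            push_cast; rw [add_assoc]; norm_num
          have h3 : (2 ^ k * r / 2) ^ e * (((k : ℝ) + 2) * (2 ^ (k + 1) * r) ^ d) =
              a k * r ^ (e + d) := by
            have h3 : (0 : ℝ) < 2 ^ k * r := by positivity
            have h4 : (2 ^ k * r) ^ e * (2 ^ k * r) ^ d = ((2 : ℝ) ^ (e + d)) ^ k * r ^ (e + d) := by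
              rw [← Real.rpow_add h3, Real.mul_rpow (by positivity) hr.le, ← Real.rpow_natCast,
                ← Real.rpow_natCast ((2 : ℝ) ^ (e + d)), ← Real.rpow_mul (by norm_num),
                ← Real.rpow_mul (by norm_num), mul_comm (k : ℝ)]
            rw [show (2 : ℝ) ^ (k + 1) * r = 2 * (2 ^ k * r) by ring,
              Real.mul_rpow (by norm_num) h3.le, Real.div_rpow h3.le (by norm_num), ha]
            simp only [Real.rpow_sub (by norm_num : (0 : ℝ) < 2)]
            linear_combination ((k : ℝ) + 2) * 2 ^ d / 2 ^ e * h4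
          rw [h2, mul_left_comm (ENNReal.ofReal (a k)), ← ENNReal.ofReal_mul (by positivity), ← h3,
            ENNReal.ofReal_mul (by positivity), ENNReal.ofReal_mul (by positivity)]
          ring
  calc _ ≤ ∫⁻ y in ⋃ k : ℕ, cube z (2 ^ (k + 1) * r) \ cube z (2 ^ k * r),
        ENNReal.ofReal (‖y - z‖ ^ e) * h y := lintegral_mono_set hcov
    _ ≤ ∑' k : ℕ, ∫⁻ y in cube z (2 ^ (k + 1) * r) \ cube z (2 ^ k * r),
        ENNReal.ofReal (‖y - z‖ ^ e) * h y := lintegral_iUnion_le _ _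
    _ ≤ ∑' k : ℕ, ENNReal.ofReal (a k) * (B * ENNReal.ofReal (r ^ (e + d))) :=
        ENNReal.tsum_le_tsum hterm
    _ = _ := by rw [ENNReal.tsum_mul_right, mul_assoc]

/-- Integral of a locally integrable power of the norm over a cube. -/
theorem exists_lintegral_cube_rpow_norm_sub_le {e : ℝ} (he : e < 0) (hen : 0 < e + n) :
    ∃ C : ℝ≥0∞, C ≠ ∞ ∧ ∀ (y z : EuclideanSpace ℝ (Fin n)) (r : ℝ), 0 < r → y ∈ cube z r →
      ∫⁻ x in cube z r, ENNReal.ofReal (‖x - y‖ ^ e) ≤ C * ENNReal.ofReal (r ^ (e + n)) := by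
  have hρ : (2⁻¹ : ℝ) ^ (e + n) < 1 := Real.rpow_lt_one (by norm_num) (by norm_num) hen
  have hρ0 : (0 : ℝ) < (2⁻¹ : ℝ) ^ (e + n) := by positivity
  set a : ℕ → ℝ := fun k ↦ (2⁻¹ : ℝ) ^ e * (2 : ℝ) ^ (n : ℝ) * ((2⁻¹ : ℝ) ^ (e + n)) ^ k with ha
  have hsum : Summable a := (summable_geometric_of_lt_one hρ0.le hρ).mul_left _
  refine ⟨∑' k, ENNReal.ofReal (a k), hsum.tsum_ofReal_ne_top, fun y z r hr hyz ↦ ?_⟩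
  set A : ℕ → ℝ := fun k ↦ 2⁻¹ ^ k * (2 * r) with hA
  have hApos (k : ℕ) : 0 < A k := by positivity
  have hcov : cube z r ⊆ {y} ∪ ⋃ k : ℕ, cube y (A k) \ cube y (A (k + 1)) := by
    intro x hx
    by_cases hxy : x = y
    · exact Or.inl hxy
    refine Or.inr ?_
    have hex : ∃ k : ℕ, x ∉ cube y (A k) := by
      by_contra! hcon
      refine hxy ?_
      ext i
      have h1 (k : ℕ) : |x i - y i| ≤ A k / 2 := hcon k i
      have h2 : Tendsto (fun k ↦ A k / 2) atTop (𝓝 0) := by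
        have := ((tendsto_pow_atTop_nhds_zero_of_lt_one (r := (2⁻¹ : ℝ)) (by norm_num)
          (by norm_num)).mul_const (2 * r)).div_const 2
        simpa [hA] using this
      have h3 : |x i - y i| ≤ 0 := ge_of_tendsto' h2 h1
      exact sub_eq_zero.1 (abs_nonpos_iff.1 h3)
    classical
    have hpos : Nat.find hex ≠ 0 := by
      intro h0
      have := Nat.find_spec hex
      rw [h0] at this
      refine this fun i ↦ ?_
      simp only [hA, pow_zero, one_mul]
      have h1 := abs_le.1 (hx i)
      have h2 := abs_le.1 (hyz i)
      rw [abs_le]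
      constructor <;> linarith
    obtain ⟨k, hk⟩ := Nat.exists_eq_succ_of_ne_zero hpos
    refine Set.mem_iUnion.2 ⟨k, not_not.1 (Nat.find_min hex (m := k) (by omega)), ?_⟩
    have := Nat.find_spec hex
    rwa [hk] at this
  have hterm (k : ℕ) : ∫⁻ x in cube y (A k) \ cube y (A (k + 1)), ENNReal.ofReal (‖x - y‖ ^ e) ≤
      ENNReal.ofReal (a k) * ENNReal.ofReal (r ^ (e + n)) := by
    calc ∫⁻ x in cube y (A k) \ cube y (A (k + 1)), ENNReal.ofReal (‖x - y‖ ^ e)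
        ≤ ∫⁻ x in cube y (A k) \ cube y (A (k + 1)), ENNReal.ofReal ((A (k + 1) / 2) ^ e) := by
          refine setLIntegral_mono' ((measurableSet_cube y (hApos _).le).diff
            (measurableSet_cube y (hApos _).le)) fun x hx ↦ ?_
          exact ENNReal.ofReal_le_ofReal
            (Real.rpow_le_rpow_of_nonpos (half_pos (hApos _)) (half_lt_norm_sub hx.2).le he.le)
      _ = ENNReal.ofReal ((A (k + 1) / 2) ^ e) * volume (cube y (A k) \ cube y (A (k + 1))) := by
          rw [lintegral_const, Measure.restrict_apply_univ]
      _ ≤ ENNReal.ofReal ((A (k + 1) / 2) ^ e) * ENNReal.ofReal (A k ^ (n : ℝ)) := by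
          rw [← volume_cube y (hApos k).le]
          gcongr
          exact Set.sdiff_subset
      _ = _ := by
          rw [← ENNReal.ofReal_mul (by positivity), ← ENNReal.ofReal_mul (by positivity)]
          congr 1
          have h1 : A (k + 1) / 2 = 2⁻¹ * ((2⁻¹) ^ k * r) := by simp only [hA, pow_succ]; ring
          have h2 : A k = 2 * ((2⁻¹) ^ k * r) := by simp only [hA]; ring
          have h3 : (0 : ℝ) < (2⁻¹) ^ k * r := by positivity
          rw [h1, h2, Real.mul_rpow (by norm_num) h3.le, Real.mul_rpow (by norm_num) h3.le, ha]
          have h4 : ((2⁻¹ : ℝ) ^ k * r) ^ e * ((2⁻¹ : ℝ) ^ k * r) ^ (n : ℝ) =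
              ((2⁻¹ : ℝ) ^ (e + n)) ^ k * r ^ (e + n) := by
            rw [← Real.rpow_add h3, Real.mul_rpow (by positivity) hr.le, ← Real.rpow_natCast,
              ← Real.rpow_natCast ((2⁻¹ : ℝ) ^ (e + n)), ← Real.rpow_mul (by norm_num),
              ← Real.rpow_mul (by norm_num), mul_comm (k : ℝ)]
          linear_combination (2⁻¹ : ℝ) ^ e * (2 : ℝ) ^ (n : ℝ) * h4
  calc _ ≤ ∫⁻ x in {y} ∪ ⋃ k : ℕ, cube y (A k) \ cube y (A (k + 1)),
        ENNReal.ofReal (‖x - y‖ ^ e) := lintegral_mono_set hcov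
    _ ≤ (∫⁻ x in {y}, ENNReal.ofReal (‖x - y‖ ^ e)) +
          ∫⁻ x in ⋃ k : ℕ, cube y (A k) \ cube y (A (k + 1)), ENNReal.ofReal (‖x - y‖ ^ e) :=
        lintegral_union_le _ _ _
    _ ≤ 0 + ∑' k : ℕ, ∫⁻ x in cube y (A k) \ cube y (A (k + 1)),
          ENNReal.ofReal (‖x - y‖ ^ e) := by
        gcongr
        · rw [lintegral_singleton]
          simp [Real.zero_rpow he.ne]
        · exact lintegral_iUnion_le _ _
    _ ≤ 0 + ∑' k : ℕ, ENNReal.ofReal (a k) * ENNReal.ofReal (r ^ (e + n)) := by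
        gcongr with k
        exact hterm k
    _ = _ := by rw [zero_add, ENNReal.tsum_mul_right]

theorem abs_rpow_sub_rpow_le {e a b : ℝ} (he : e < 0) (ha : 0 < a) (hb : a / 2 ≤ b) :
    |a ^ e - b ^ e| ≤ |e| * (a / 2) ^ (e - 1) * |a - b| := by
  have hd : ∀ t ∈ Set.Ici (a / 2), HasDerivWithinAt (fun t : ℝ ↦ t ^ e) (e * t ^ (e - 1))
      (Set.Ici (a / 2)) t := fun t ht ↦
    (Real.hasDerivAt_rpow_const (Or.inl (lt_of_lt_of_le (half_pos ha) ht).ne')).hasDerivWithinAt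
  have hbd : ∀ t ∈ Set.Ici (a / 2), ‖e * t ^ (e - 1)‖ ≤ |e| * (a / 2) ^ (e - 1) := by
    intro t ht
    have ht0 : 0 < t := lt_of_lt_of_le (half_pos ha) ht
    rw [norm_mul, Real.norm_eq_abs, Real.norm_eq_abs, abs_of_pos (Real.rpow_pos_of_pos ht0 _)]
    exact mul_le_mul_of_nonneg_left
      (Real.rpow_le_rpow_of_nonpos (half_pos ha) ht (by linarith)) (abs_nonneg _)
  exact (convex_Ici (a / 2)).norm_image_sub_le_of_norm_hasDerivWithin_le hd hbd hb
    (Set.mem_Ici.2 (by linarith))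

theorem norm_normalize_sub_le {u v : EuclideanSpace ℝ (Fin n)} (hu : u ≠ 0) (hv : v ≠ 0) :
    ‖‖u‖⁻¹ • u - ‖v‖⁻¹ • v‖ ≤ 2 * ‖u - v‖ / ‖u‖ := by
  have hu' : 0 < ‖u‖ := norm_pos_iff.2 hu
  have hv' : 0 < ‖v‖ := norm_pos_iff.2 hv
  rw [le_div_iff₀ hu', mul_comm, ← abs_of_pos hu', ← Real.norm_eq_abs, ← norm_smul,
    Real.norm_eq_abs, abs_of_pos hu', smul_sub, smul_smul, smul_smul, mul_inv_cancel₀ hu'.ne',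
    one_smul]
  have : u - (‖u‖ * ‖v‖⁻¹) • v = (u - v) + ((‖v‖ - ‖u‖) * ‖v‖⁻¹) • v := by
    rw [sub_mul, mul_inv_cancel₀ hv'.ne', sub_smul, one_smul]; abel
  rw [this]
  refine (norm_add_le _ _).trans ?_
  rw [norm_smul, norm_mul, norm_inv, norm_norm, mul_assoc, inv_mul_cancel₀ hv'.ne', mul_one,
    Real.norm_eq_abs, two_mul]
  gcongr
  rw [norm_sub_rev]
  exact abs_norm_sub_norm_le v u

theorem HomogZero.apply_normalize {Ω : EuclideanSpace ℝ (Fin n) → ℝ} (hhom : HomogZero Ω)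
    {u : EuclideanSpace ℝ (Fin n)} (hu : u ≠ 0) : Ω (‖u‖⁻¹ • u) = Ω u :=
  hhom _ (inv_pos.2 (norm_pos_iff.2 hu)) u hu

theorem normalize_mem_sphere {u : EuclideanSpace ℝ (Fin n)} (hu : u ≠ 0) :
    ‖u‖⁻¹ • u ∈ sphere (0 : EuclideanSpace ℝ (Fin n)) 1 := by
  rw [mem_sphere_zero_iff_norm, norm_smul, norm_inv, norm_norm,
    inv_mul_cancel₀ (norm_ne_zero_iff.2 hu)]

variable {Ω : EuclideanSpace ℝ (Fin n) → ℝ}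

theorem HomogZero.exists_bound (hhom : HomogZero Ω)
    (hΩ : ContinuousOn Ω (sphere (0 : EuclideanSpace ℝ (Fin n)) 1)) :
    ∃ M : ℝ, 0 ≤ M ∧ ∀ u, u ≠ 0 → |Ω u| ≤ M := by
  obtain ⟨M, hM⟩ := (isCompact_sphere (0 : EuclideanSpace ℝ (Fin n)) 1).exists_bound_of_continuousOn
    hΩ
  refine ⟨max M 0, le_max_right _ _, fun u hu ↦ ?_⟩
  rw [← hhom.apply_normalize hu]
  exact (hM _ (normalize_mem_sphere hu)).trans (le_max_left _ _)

theorem HomogZero.measurable (hhom : HomogZero Ω)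
    (hΩ : ContinuousOn Ω (sphere (0 : EuclideanSpace ℝ (Fin n)) 1)) : Measurable Ω := by
  refine measurable_of_continuousOn_compl_singleton 0 ?_
  have h : ContinuousOn (fun u : EuclideanSpace ℝ (Fin n) ↦ ‖u‖⁻¹ • u) {0}ᶜ :=
    (continuous_norm.continuousOn.inv₀ fun u hu ↦ norm_ne_zero_iff.2 hu).smul continuousOn_id
  exact (hΩ.comp h fun u hu ↦ normalize_mem_sphere hu).congr fun u hu ↦
    (hhom.apply_normalize hu).symm

theorem HomogZero.exists_kernel_bound (hhom : HomogZero Ω)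
    (hΩ : ContinuousOn Ω (sphere (0 : EuclideanSpace ℝ (Fin n)) 1)) {e : ℝ} (he : e < 0) :
    ∃ M : ℝ, 0 ≤ M ∧ ∀ u, |Ω u * ‖u‖ ^ e| ≤ M * ‖u‖ ^ e := by
  obtain ⟨M, hM0, hM⟩ := hhom.exists_bound hΩ
  refine ⟨M, hM0, fun u ↦ ?_⟩
  rcases eq_or_ne u 0 with rfl | hu
  · simp [Real.zero_rpow he.ne]
  rw [abs_mul, abs_of_nonneg (Real.rpow_nonneg (norm_nonneg u) e)]
  gcongr
  exact hM u hu

/-- Regularity of the kernel `Ω(u) ‖u‖ ^ e`. -/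
theorem HomogZero.exists_kernel_sub_bound (hhom : HomogZero Ω) {L : NNReal}
    (hΩ : LipschitzOnWith L Ω (sphere (0 : EuclideanSpace ℝ (Fin n)) 1)) {e : ℝ} (he : e < 0) :
    ∃ M : ℝ, 0 ≤ M ∧ ∀ u v, u ≠ 0 → ‖u - v‖ ≤ ‖u‖ / 2 →
      |Ω u * ‖u‖ ^ e - Ω v * ‖v‖ ^ e| ≤ M * ‖u - v‖ * ‖u‖ ^ (e - 1) := by
  obtain ⟨M, hM0, hM⟩ := hhom.exists_bound hΩ.continuousOn
  refine ⟨2 * L + M * (|e| * 2⁻¹ ^ (e - 1)) , by positivity, fun u v hu huv ↦ ?_⟩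
  have hu' : 0 < ‖u‖ := norm_pos_iff.2 hu
  have hvu : ‖u‖ / 2 ≤ ‖v‖ := by
    have := norm_sub_norm_le u v
    linarith
  have hv : v ≠ 0 := norm_pos_iff.1 (lt_of_lt_of_le (half_pos hu') hvu)
  have h1 : |Ω u - Ω v| ≤ L * (2 * ‖u - v‖ / ‖u‖) := by
    rw [← hhom.apply_normalize hu, ← hhom.apply_normalize hv, ← Real.dist_eq]
    refine (hΩ.dist_le_mul _ (normalize_mem_sphere hu) _ (normalize_mem_sphere hv)).trans ?_
    rw [dist_eq_norm]
    gcongr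
    exact norm_normalize_sub_le hu hv
  have h2 : |‖u‖ ^ e - ‖v‖ ^ e| ≤ |e| * (‖u‖ / 2) ^ (e - 1) * ‖u - v‖ := by
    refine (abs_rpow_sub_rpow_le he hu' hvu).trans ?_
    gcongr
    exact abs_norm_sub_norm_le u v
  have h3 : ‖u‖ ^ e = ‖u‖ ^ (e - 1) * ‖u‖ := by
    rw [← Real.rpow_add_one hu'.ne', sub_add_cancel]
  calc |Ω u * ‖u‖ ^ e - Ω v * ‖v‖ ^ e|
      = |(Ω u - Ω v) * ‖u‖ ^ e + Ω v * (‖u‖ ^ e - ‖v‖ ^ e)| := by congr 1; ring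
    _ ≤ |Ω u - Ω v| * ‖u‖ ^ e + |Ω v| * |‖u‖ ^ e - ‖v‖ ^ e| := by
        refine (abs_add_le _ _).trans_eq ?_
        rw [abs_mul, abs_mul, abs_of_nonneg (Real.rpow_nonneg (norm_nonneg u) e)]
    _ ≤ L * (2 * ‖u - v‖ / ‖u‖) * ‖u‖ ^ e + M * (|e| * (‖u‖ / 2) ^ (e - 1) * ‖u - v‖) := by
        gcongr
        exact hM v hv
    _ = _ := by
        rw [h3, div_eq_mul_inv ‖u‖ 2, Real.mul_rpow (norm_nonneg u) (by norm_num)]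
        field_simp

end Kernel

section Commutator

open Filter Topology

variable {n : ℕ}

theorem ofReal_rpow_volume_cube (z : EuclideanSpace ℝ (Fin n)) {r : ℝ} (hr : 0 < r) (t : ℝ) :
    volume (cube z r) ^ t = ENNReal.ofReal (r ^ (n * t)) := by
  rw [volume_cube z hr.le, ENNReal.ofReal_rpow_of_pos (Real.rpow_pos_of_pos hr _),
    ← Real.rpow_mul hr.le]

theorem ofReal_abs_rpow_abs (a : ℝ) {η : ℝ} (hη : 0 ≤ η) :
    ENNReal.ofReal |(|a| ^ η)| = ‖a‖ₑ ^ η := by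
  rw [abs_of_nonneg (by positivity), Real.enorm_eq_ofReal_abs,
    ENNReal.ofReal_rpow_of_nonneg (abs_nonneg a) hη]

theorem lintegral_cube_rpow_le_fracMax (g : EuclideanSpace ℝ (Fin n) → ℝ) {γ η : ℝ} (hη : 0 ≤ η)
    {x z : EuclideanSpace ℝ (Fin n)} {r : ℝ} (hr : 0 < r) (hx : x ∈ cube z r) :
    ∫⁻ y in cube z r, ‖g y‖ₑ ^ η ≤
      volume (cube z r) ^ (1 - γ / n) * fracMax γ (fun y ↦ |g y| ^ η) x := by
  have h : volume (cube z r) ^ (γ / n - 1) *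
      ∫⁻ y in cube z r, ENNReal.ofReal |(|g y| ^ η)| ≤ fracMax γ (fun y ↦ |g y| ^ η) x :=
    le_iSup_of_le z (le_iSup_of_le r (le_iSup_of_le hr (le_iSup_of_le hx le_rfl)))
  simp_rw [ofReal_abs_rpow_abs _ hη] at h
  calc ∫⁻ y in cube z r, ‖g y‖ₑ ^ η
      = volume (cube z r) ^ (1 - γ / n) *
          (volume (cube z r) ^ (γ / n - 1) * ∫⁻ y in cube z r, ‖g y‖ₑ ^ η) := by
        rw [← mul_assoc, ← ENNReal.rpow_add _ _ (volume_cube_ne_zero z hr)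
          (volume_cube_ne_top z hr.le), show 1 - γ / n + (γ / n - 1) = 0 by ring,
          ENNReal.rpow_zero, one_mul]
    _ ≤ _ := by gcongr

theorem exists_lintegral_cube_pow_enorm_sub_mul_le_fracMax (hn : 1 ≤ n) {η : ℝ} (hη : 1 < η)
    (γ : ℝ) :
    ∃ C : ℝ≥0∞, C ≠ ∞ ∧ ∀ b : EuclideanSpace ℝ (Fin n) → ℝ, MemBMO b →
      ∀ g : EuclideanSpace ℝ (Fin n) → ℝ, AEMeasurable g →
      ∀ (x z : EuclideanSpace ℝ (Fin n)) (r : ℝ), 0 < r → x ∈ cube z r → ∀ k : ℕ,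
        ∫⁻ y in cube z (2 ^ k * r), ‖b y - setAvg (cube z (2 * (n * r))) b‖ₑ * ‖g y‖ₑ ≤
          (C * bmoNorm b * fracMax (γ * η) (fun y ↦ |g y| ^ η) x ^ (1 / η)) * (k + 1) *
            ENNReal.ofReal ((2 ^ k * r) ^ (n - γ)) := by
  obtain ⟨C, hC, h⟩ := exists_lintegral_cube_pow_enorm_sub_mul_le hn hη
  refine ⟨C, hC, fun b hb g hg x z r hr hx k ↦ ?_⟩
  have hη0 : 0 < η := by linarith
  have hn0 : (n : ℝ) ≠ 0 := by positivity
  have hkr : 0 < 2 ^ k * r := by positivity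
  have hxk : x ∈ cube z (2 ^ k * r) :=
    cube_subset_cube z (le_mul_of_one_le_left hr.le (one_le_pow₀ (by norm_num))) hx
  refine (h b hb _ hg.enorm z r hr k).trans ?_
  refine (mul_le_mul_right (ENNReal.rpow_le_rpow (lintegral_cube_rpow_le_fracMax g (γ := γ * η)
    hη0.le hkr hxk) (by positivity : 0 ≤ 1 / η)) _).trans_eq ?_
  have hexp : ENNReal.ofReal ((2 ^ k * r) ^ (n - γ)) =
      volume (cube z (2 ^ k * r)) ^ (1 - 1 / η) *
        volume (cube z (2 ^ k * r)) ^ ((1 - γ * η / n) * (1 / η)) := by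
    rw [← ENNReal.rpow_add _ _ (volume_cube_ne_zero z hkr) (volume_cube_ne_top z hkr.le),
      ofReal_rpow_volume_cube z hkr]
    congr 2
    field_simp
    ring
  rw [hexp, ENNReal.mul_rpow_of_nonneg _ _ (by positivity), ← ENNReal.rpow_mul]
  ring

theorem lintegral_rpow_enorm_eq_lpNorm_rpow (f : EuclideanSpace ℝ (Fin n) → ℝ) (p : ℝ) :
    (∫⁻ y, ‖f y‖ₑ ^ p) ^ (1 / p) = lpNorm p f := by
  simp only [_root_.lpNorm, Real.enorm_eq_ofReal_abs]

theorem exists_lintegral_cube_pow_enorm_sub_mul_le_lpNorm (hn : 1 ≤ n) {p : ℝ} (hp : 1 < p) :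
    ∃ C : ℝ≥0∞, C ≠ ∞ ∧ ∀ b : EuclideanSpace ℝ (Fin n) → ℝ, MemBMO b →
      ∀ f : EuclideanSpace ℝ (Fin n) → ℝ, AEMeasurable f →
      ∀ (z : EuclideanSpace ℝ (Fin n)) (r : ℝ), 0 < r → ∀ k : ℕ,
        ∫⁻ y in cube z (2 ^ k * r), ‖b y - setAvg (cube z (2 * (n * r))) b‖ₑ * ‖f y‖ₑ ≤
          (C * bmoNorm b * lpNorm p f) * (k + 1) * ENNReal.ofReal ((2 ^ k * r) ^ (n - n / p)) := by
  obtain ⟨C, hC, h⟩ := exists_lintegral_cube_pow_enorm_sub_mul_le hn hp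
  refine ⟨C, hC, fun b hb f hf z r hr k ↦ ?_⟩
  have hkr : 0 < 2 ^ k * r := by positivity
  have hp0 : 0 ≤ 1 / p := by positivity
  refine (h b hb _ hf.enorm z r hr k).trans ?_
  rw [← lintegral_rpow_enorm_eq_lpNorm_rpow, ofReal_rpow_volume_cube z hkr,
    show (n : ℝ) * (1 - 1 / p) = n - n / p by ring]
  refine (mul_le_mul_right (ENNReal.rpow_le_rpow (setLIntegral_le_lintegral
    (cube z (2 ^ k * r)) _) hp0) _).trans_eq ?_
  ring

theorem lintegral_cube_pow_enorm_le_lpNorm {p : ℝ} (hp : 1 < p)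
    {f : EuclideanSpace ℝ (Fin n) → ℝ} (hf : AEMeasurable f)
    (z : EuclideanSpace ℝ (Fin n)) {r : ℝ} (hr : 0 < r) (k : ℕ) :
    ∫⁻ y in cube z (2 ^ k * r), ‖f y‖ₑ ≤
      lpNorm p f * (k + 1) * ENNReal.ofReal ((2 ^ k * r) ^ (n - n / p)) := by
  have hc : p.HolderConjugate (Real.conjExponent p) := Real.HolderConjugate.conjExponent hp
  have hkr : 0 < 2 ^ k * r := by positivity
  have hp0 : 0 ≤ 1 / p := by positivity
  have he : (n : ℝ) * (1 / Real.conjExponent p) = n - n / p := by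
    have := hc.inv_add_inv_eq_one
    rw [one_div, show (Real.conjExponent p)⁻¹ = 1 - p⁻¹ by linarith]
    ring
  calc ∫⁻ y in cube z (2 ^ k * r), ‖f y‖ₑ
      = ∫⁻ y in cube z (2 ^ k * r), ‖f y‖ₑ * 1 := by simp
    _ ≤ (∫⁻ y in cube z (2 ^ k * r), ‖f y‖ₑ ^ p) ^ (1 / p) *
          (∫⁻ _ in cube z (2 ^ k * r), 1 ^ Real.conjExponent p) ^ (1 / Real.conjExponent p) :=
        ENNReal.lintegral_mul_le_Lp_mul_Lq _ hc hf.enorm.restrict aemeasurable_const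
    _ ≤ lpNorm p f * ENNReal.ofReal ((2 ^ k * r) ^ (n - n / p)) := by
        rw [ENNReal.one_rpow, lintegral_const, Measure.restrict_apply_univ, one_mul,
          ofReal_rpow_volume_cube z hkr, he, ← lintegral_rpow_enorm_eq_lpNorm_rpow]
        exact mul_le_mul_left (ENNReal.rpow_le_rpow (setLIntegral_le_lintegral _ _) hp0) _
    _ ≤ _ := by
        gcongr
        exact le_mul_of_one_le_right' le_add_self

/-- Tonelli's theorem for a weakly singular kernel on a cube. -/
theorem exists_lintegral_cube_lintegral_cube_le {e : ℝ} (he : e < 0) (hen : 0 < e + n) :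
    ∃ C : ℝ≥0∞, C ≠ ∞ ∧ ∀ h : EuclideanSpace ℝ (Fin n) → ℝ≥0∞, AEMeasurable h →
      ∀ (z : EuclideanSpace ℝ (Fin n)) (r : ℝ), 0 < r →
        ∫⁻ y in cube z r, ∫⁻ w in cube z r, ENNReal.ofReal (‖y - w‖ ^ e) * h w ≤
          C * ENNReal.ofReal (r ^ (e + n)) * ∫⁻ w in cube z r, h w := by
  obtain ⟨C, hC, hle⟩ := exists_lintegral_cube_rpow_norm_sub_le he hen
  refine ⟨C, hC, fun h hh z r hr ↦ ?_⟩
  have hk : Measurable fun q : EuclideanSpace ℝ (Fin n) × EuclideanSpace ℝ (Fin n) ↦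
      ENNReal.ofReal (‖q.1 - q.2‖ ^ e) := by fun_prop
  rw [lintegral_lintegral_swap (hk.aemeasurable.mul hh.restrict.comp_snd)]
  calc ∫⁻ w in cube z r, ∫⁻ y in cube z r, ENNReal.ofReal (‖y - w‖ ^ e) * h w
      = ∫⁻ w in cube z r, (∫⁻ y in cube z r, ENNReal.ofReal (‖y - w‖ ^ e)) * h w := by
        refine lintegral_congr fun w ↦ lintegral_mul_const _ ?_
        fun_prop
    _ ≤ ∫⁻ w in cube z r, C * ENNReal.ofReal (r ^ (e + n)) * h w := by
        refine setLIntegral_mono' (measurableSet_cube z hr.le) fun w hw ↦ ?_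
        exact mul_le_mul_left (hle w z r hr hw) _
    _ = _ := lintegral_const_mul' _ _ (ENNReal.mul_ne_top hC ENNReal.ofReal_ne_top)

theorem lintegral_compl_cube_ne_top {e d : ℝ} (he : e ≤ 0) (hed : e + d < 0)
    {h : EuclideanSpace ℝ (Fin n) → ℝ≥0∞} {B : ℝ≥0∞} (hB : B ≠ ∞)
    {z : EuclideanSpace ℝ (Fin n)} {r : ℝ} (hr : 0 < r)
    (hgrowth : ∀ k : ℕ, ∫⁻ y in cube z (2 ^ k * r), h y ≤
      B * (k + 1) * ENNReal.ofReal ((2 ^ k * r) ^ d)) :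
    ∫⁻ y in (cube z r)ᶜ, ENNReal.ofReal (‖y - z‖ ^ e) * h y ≠ ∞ := by
  obtain ⟨C, hC, hfar⟩ := exists_lintegral_compl_cube_rpow_mul_le n he hed
  exact ((hfar h B z r hr hgrowth).trans_lt (by finiteness)).ne

theorem norm_sub_le_half_of_mem_cube {y w z : EuclideanSpace ℝ (Fin n)} {r : ℝ} (hr : 0 < r)
    (hy : y ∈ cube z r) (hw : w ∉ cube z (2 * (n * r))) : ‖z - y‖ ≤ ‖z - w‖ / 2 := by
  have h1 := norm_sub_le_of_mem_cube hr.le hy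
  have h2 := half_lt_norm_sub hw
  rw [norm_sub_rev z y, norm_sub_rev z w]
  linarith

/-- The Riesz potential of a function of controlled growth is finite almost everywhere. -/
theorem ae_lintegral_rpow_mul_lt_top (hn : 1 ≤ n) {e d : ℝ} (he : e < 0) (hen : 0 < e + n)
    (hed : e + d < 0) {h : EuclideanSpace ℝ (Fin n) → ℝ≥0∞} (hh : AEMeasurable h) {B : ℝ≥0∞}
    (hB : B ≠ ∞) {z : EuclideanSpace ℝ (Fin n)} {r : ℝ} (hr : 0 < r)
    (hgrowth : ∀ k : ℕ, ∫⁻ y in cube z (2 ^ k * (2 * (n * r))), h y ≤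
      B * (k + 1) * ENNReal.ofReal ((2 ^ k * (2 * (n * r))) ^ d)) :
    ∀ᵐ y ∂volume.restrict (cube z r), ∫⁻ w, ENNReal.ofReal (‖y - w‖ ^ e) * h w < ∞ := by
  have hn1 : (1 : ℝ) ≤ n := by exact_mod_cast hn
  set R : ℝ := 2 * (n * r) with hR
  have hR0 : 0 < R := by positivity
  have hrR : r ≤ R := by nlinarith
  obtain ⟨C, hC, hloc⟩ := exists_lintegral_cube_lintegral_cube_le he hen
  have h0 : ∫⁻ w in cube z R, h w ≠ ∞ := by
    have := hgrowth 0
    rw [pow_zero, one_mul] at this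
    exact (this.trans_lt (by finiteness)).ne
  have hmeas : AEMeasurable (fun y ↦ ∫⁻ w in cube z R, ENNReal.ofReal (‖y - w‖ ^ e) * h w)
      (volume.restrict (cube z R)) := by
    have hk : Measurable fun q : EuclideanSpace ℝ (Fin n) × EuclideanSpace ℝ (Fin n) ↦
      ENNReal.ofReal (‖q.1 - q.2‖ ^ e) := by fun_prop
    exact (hk.aemeasurable.mul hh.restrict.comp_snd).lintegral_prod_right'
  have hae := ae_lt_top' hmeas ((hloc h hh z R hR0).trans_lt (by finiteness)).ne
  have hae' := ae_mono (Measure.restrict_mono (cube_subset_cube z hrR) le_rfl) hae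
  filter_upwards [hae', ae_restrict_mem (measurableSet_cube z hr.le)] with y hy hyz
  rw [← lintegral_add_compl _ (measurableSet_cube z hR0.le)]
  refine ENNReal.add_lt_top.2 ⟨hy, ?_⟩
  calc ∫⁻ w in (cube z R)ᶜ, ENNReal.ofReal (‖y - w‖ ^ e) * h w
      ≤ ∫⁻ w in (cube z R)ᶜ, ENNReal.ofReal (2⁻¹ ^ e) * (ENNReal.ofReal (‖w - z‖ ^ e) * h w) := by
        refine setLIntegral_mono' (measurableSet_cube z hR0.le).compl fun w hw ↦ ?_
        rw [← mul_assoc, ← ENNReal.ofReal_mul (by positivity),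
          ← Real.mul_rpow (by norm_num) (norm_nonneg _)]
        refine mul_le_mul_left (ENNReal.ofReal_le_ofReal ?_) _
        have h1 := half_lt_norm_sub hw
        have h2 := norm_sub_le_half_of_mem_cube hr hyz hw
        have h3 := norm_sub_le_norm_sub_add_norm_sub z y w
        rw [norm_sub_rev z w] at h2 h3
        refine Real.rpow_le_rpow_of_nonpos (by linarith) (by linarith) he.le
    _ = ENNReal.ofReal (2⁻¹ ^ e) * ∫⁻ w in (cube z R)ᶜ, ENNReal.ofReal (‖w - z‖ ^ e) * h w :=
        lintegral_const_mul' _ _ ENNReal.ofReal_ne_top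
    _ < ∞ := ENNReal.mul_lt_top ENNReal.ofReal_lt_top
        (lintegral_compl_cube_ne_top he.le hed hB hR0 hgrowth).lt_top

/-- The mean oscillation is at most twice the mean deviation from any constant. -/
theorem inv_volume_mul_lintegral_sub_setAvg_le {F : EuclideanSpace ℝ (Fin n) → ℝ}
    (hF : AEMeasurable F) {Q : Set (EuclideanSpace ℝ (Fin n))} (hQ0 : volume Q ≠ 0)
    (hQ : volume Q ≠ ∞) (a : ℝ) {X : ℝ≥0∞} (hX : ∫⁻ y in Q, ‖F y - a‖ₑ ≤ X * volume Q) :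
    (volume Q)⁻¹ * ∫⁻ y in Q, ENNReal.ofReal |F y - setAvg Q F| ≤ 2 * X := by
  rcases eq_or_ne X ∞ with rfl | hXt
  · simp
  have hV : 0 < (volume Q).toReal := ENNReal.toReal_pos hQ0 hQ
  have hint : IntegrableOn (fun y ↦ F y - a) Q :=
    ⟨(hF.sub_const a).aestronglyMeasurable.restrict, hX.trans_lt (by finiteness)⟩
  have hintF : IntegrableOn F Q := by
    have := hint.add (integrableOn_const hQ (C := a))
    simpa [Pi.add_def] using this
  have havg : setAvg Q F - a = (volume Q).toReal⁻¹ * ∫ y in Q, (F y - a) := by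
    rw [setAvg, integral_sub hintF (integrableOn_const hQ), setIntegral_const, smul_eq_mul,
      Measure.real]
    field_simp
  have hle : ‖setAvg Q F - a‖ₑ ≤ X := by
    rw [havg, enorm_mul, enorm_inv hV.ne', Real.enorm_eq_ofReal hV.le, ENNReal.ofReal_toReal hQ,
      ENNReal.inv_mul_le_iff hQ0 hQ, mul_comm]
    exact (enorm_integral_le_lintegral_enorm _).trans hX
  rw [ENNReal.inv_mul_le_iff hQ0 hQ]
  calc ∫⁻ y in Q, ENNReal.ofReal |F y - setAvg Q F|
      ≤ ∫⁻ y in Q, (‖F y - a‖ₑ + ‖setAvg Q F - a‖ₑ) := by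
        refine lintegral_mono fun y ↦ ?_
        rw [← Real.enorm_eq_ofReal_abs, ← enorm_neg (setAvg Q F - a),
          show F y - setAvg Q F = (F y - a) + -(setAvg Q F - a) by ring]
        exact enorm_add_le _ _
    _ = (∫⁻ y in Q, ‖F y - a‖ₑ) + ‖setAvg Q F - a‖ₑ * volume Q := by
        rw [lintegral_add_right _ measurable_const, lintegral_const, Measure.restrict_apply_univ]
    _ ≤ X * volume Q + X * volume Q := add_le_add hX (mul_le_mul_left hle _)
    _ = _ := by ring

theorem aestronglyMeasurable_fracInt {Ω : EuclideanSpace ℝ (Fin n) → ℝ} (hΩ : Measurable Ω) (α : ℝ)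
    {f : EuclideanSpace ℝ (Fin n) → ℝ} (hf : AEStronglyMeasurable f) :
    AEStronglyMeasurable (fracInt Ω α f) := by
  have hk : Measurable fun q : EuclideanSpace ℝ (Fin n) × EuclideanSpace ℝ (Fin n) ↦
      Ω (q.1 - q.2) * ‖q.1 - q.2‖ ^ (α - n) :=
    (hΩ.comp (measurable_fst.sub measurable_snd)).mul (by fun_prop)
  exact (hk.aestronglyMeasurable.mul hf.comp_snd).integral_prod_right'

end Commutator

section SharpEstimate

variable {n : ℕ}

theorem integrable_kernel_mul {Ω : EuclideanSpace ℝ (Fin n) → ℝ} (hΩ : Measurable Ω) {α M : ℝ}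
    (hM0 : 0 ≤ M) (hM : ∀ u, |Ω u * ‖u‖ ^ (α - n)| ≤ M * ‖u‖ ^ (α - n))
    {g : EuclideanSpace ℝ (Fin n) → ℝ} {μ : Measure (EuclideanSpace ℝ (Fin n))}
    (hg : AEStronglyMeasurable g μ) {y : EuclideanSpace ℝ (Fin n)}
    (hy : ∫⁻ w, ENNReal.ofReal (‖y - w‖ ^ (α - n)) * ‖g w‖ₑ ∂μ < ∞) :
    Integrable (fun w ↦ Ω (y - w) * ‖y - w‖ ^ (α - n) * g w) μ := by
  have hk : Measurable fun w ↦ Ω (y - w) * ‖y - w‖ ^ (α - n) :=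
    (hΩ.comp (measurable_const.sub measurable_id)).mul (by fun_prop)
  refine ⟨hk.aestronglyMeasurable.mul hg, ?_⟩
  calc ∫⁻ w, ‖Ω (y - w) * ‖y - w‖ ^ (α - n) * g w‖ₑ ∂μ
      ≤ ∫⁻ w, ENNReal.ofReal M * (ENNReal.ofReal (‖y - w‖ ^ (α - n)) * ‖g w‖ₑ) ∂μ := by
        refine lintegral_mono fun w ↦ ?_
        rw [enorm_mul, ← mul_assoc, ← ENNReal.ofReal_mul hM0, Real.enorm_eq_ofReal_abs]
        exact mul_le_mul_left (ENNReal.ofReal_le_ofReal (hM _)) _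
    _ = ENNReal.ofReal M * ∫⁻ w, ENNReal.ofReal (‖y - w‖ ^ (α - n)) * ‖g w‖ₑ ∂μ :=
        lintegral_const_mul' _ _ ENNReal.ofReal_ne_top
    _ < ∞ := ENNReal.mul_lt_top ENNReal.ofReal_lt_top hy

theorem commutatorOp_eq_sub_const {Ω : EuclideanSpace ℝ (Fin n) → ℝ} {α : ℝ}
    {b f : EuclideanSpace ℝ (Fin n) → ℝ} (c : ℝ) {y : EuclideanSpace ℝ (Fin n)}
    (hf : Integrable fun w ↦ Ω (y - w) * ‖y - w‖ ^ (α - n) * f w)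
    (hbf : Integrable fun w ↦ Ω (y - w) * ‖y - w‖ ^ (α - n) * ((b w - c) * f w)) :
    commutatorOp Ω α b f y =
      (b y - c) * fracInt Ω α f y - fracInt Ω α (fun w ↦ (b w - c) * f w) y := by
  have h : fracInt Ω α (fun w ↦ b w * f w) y =
      fracInt Ω α (fun w ↦ (b w - c) * f w) y + c * fracInt Ω α f y := by
    simp only [fracInt]
    rw [← integral_const_mul, ← integral_add hbf (hf.const_mul c)]
    congr 1 with w
    ring
  rw [commutatorOp, h]
  ring

/-- Splitting of the commutator around a cube into a local part and a smooth far part. -/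
theorem enorm_commutatorOp_add_le {Ω : EuclideanSpace ℝ (Fin n) → ℝ} {α M M' : ℝ}
    (hM0 : 0 ≤ M) (hM : ∀ u, |Ω u * ‖u‖ ^ (α - n)| ≤ M * ‖u‖ ^ (α - n))
    (hM0' : 0 ≤ M') (hM' : ∀ u v : EuclideanSpace ℝ (Fin n), u ≠ 0 → ‖u - v‖ ≤ ‖u‖ / 2 →
      |Ω u * ‖u‖ ^ (α - n) - Ω v * ‖v‖ ^ (α - n)| ≤ M' * ‖u - v‖ * ‖u‖ ^ (α - n - 1))
    {b f : EuclideanSpace ℝ (Fin n) → ℝ} (c : ℝ) {z y : EuclideanSpace ℝ (Fin n)} {r : ℝ}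
    (hr : 0 < r) (hy : y ∈ cube z r)
    (hf : Integrable fun w ↦ Ω (y - w) * ‖y - w‖ ^ (α - n) * f w)
    (hbf : Integrable fun w ↦ Ω (y - w) * ‖y - w‖ ^ (α - n) * ((b w - c) * f w))
    (hz : IntegrableOn (fun w ↦ Ω (z - w) * ‖z - w‖ ^ (α - n) * ((b w - c) * f w))
      (cube z (2 * (n * r)))ᶜ) :
    ‖commutatorOp Ω α b f y + ∫ w in (cube z (2 * (n * r)))ᶜ,
        Ω (z - w) * ‖z - w‖ ^ (α - n) * ((b w - c) * f w)‖ₑ ≤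
      ‖b y - c‖ₑ * ‖fracInt Ω α f y‖ₑ +
        ENNReal.ofReal M * (∫⁻ w in cube z (2 * (n * r)),
          ENNReal.ofReal (‖y - w‖ ^ (α - n)) * (‖b w - c‖ₑ * ‖f w‖ₑ)) +
        ENNReal.ofReal (M' * (n * (r / 2))) * ∫⁻ w in (cube z (2 * (n * r)))ᶜ,
          ENNReal.ofReal (‖w - z‖ ^ (α - n - 1)) * (‖b w - c‖ₑ * ‖f w‖ₑ) := by
  set Q := cube z (2 * (n * r)) with hQ
  have hQm : MeasurableSet Q := measurableSet_cube z (by positivity)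
  have hsplit : commutatorOp Ω α b f y +
      ∫ w in Qᶜ, Ω (z - w) * ‖z - w‖ ^ (α - n) * ((b w - c) * f w) =
      (b y - c) * fracInt Ω α f y -
        (∫ w in Q, Ω (y - w) * ‖y - w‖ ^ (α - n) * ((b w - c) * f w)) +
        ∫ w in Qᶜ, (Ω (z - w) * ‖z - w‖ ^ (α - n) - Ω (y - w) * ‖y - w‖ ^ (α - n)) *
          ((b w - c) * f w) := by
    simp_rw [sub_mul (Ω (z - _) * _)]
    rw [commutatorOp_eq_sub_const c hf hbf, integral_sub hz hbf.integrableOn,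
      fracInt.eq_1 Ω α (fun w ↦ (b w - c) * f w), ← integral_add_compl hQm hbf]
    ring
  rw [hsplit]
  refine (enorm_add_le _ _).trans (add_le_add ((enorm_sub_le).trans
    (add_le_add (enorm_mul _ _).le ?_)) ?_)
  · refine (enorm_integral_le_lintegral_enorm _).trans ?_
    rw [← lintegral_const_mul' _ _ ENNReal.ofReal_ne_top]
    refine lintegral_mono fun w ↦ ?_
    rw [enorm_mul, enorm_mul (b w - c), ← mul_assoc (ENNReal.ofReal M), ← ENNReal.ofReal_mul hM0,
      Real.enorm_eq_ofReal_abs (_ * _)]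
    exact mul_le_mul_left (ENNReal.ofReal_le_ofReal (hM _)) _
  · refine (enorm_integral_le_lintegral_enorm _).trans ?_
    rw [← lintegral_const_mul' _ _ ENNReal.ofReal_ne_top]
    refine setLIntegral_mono' hQm.compl fun w hw ↦ ?_
    rw [enorm_mul, enorm_mul (b w - c), ← mul_assoc (ENNReal.ofReal _),
      ← ENNReal.ofReal_mul (by positivity), Real.enorm_eq_ofReal_abs (_ - _)]
    refine mul_le_mul_left (ENNReal.ofReal_le_ofReal ?_) _
    have hzw : z - w ≠ 0 := by
      rintro h
      rw [sub_eq_zero] at h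
      have := half_lt_norm_sub hw
      rw [h, sub_self, norm_zero] at this
      have : 0 ≤ (n : ℝ) * r := by positivity
      linarith
    have hd : (z - w) - (y - w) = z - y := by abel
    have h1 := hM' (z - w) (y - w) hzw (by rw [hd]; exact norm_sub_le_half_of_mem_cube hr hy hw)
    rw [hd, norm_sub_rev z y, norm_sub_rev z w] at h1
    rw [norm_sub_rev z w]
    refine h1.trans ?_
    gcongr
    exact norm_sub_le_of_mem_cube hr.le hy

theorem ae_commutator_kernel_integrable (hn : 1 ≤ n) {α p : ℝ} (hα0 : 0 < α) (hαn : α < n)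
    (hp1 : 1 < p) (hp : p < n / α) {Ω : EuclideanSpace ℝ (Fin n) → ℝ} (hΩ : Measurable Ω) {M : ℝ}
    (hM0 : 0 ≤ M) (hM : ∀ u, |Ω u * ‖u‖ ^ (α - n)| ≤ M * ‖u‖ ^ (α - n))
    {b f : EuclideanSpace ℝ (Fin n) → ℝ} (hb : MemBMO b) (hf : Measurable f)
    (hfp : lpNorm p f ≠ ∞) (z : EuclideanSpace ℝ (Fin n)) {r : ℝ} (hr : 0 < r) :
    let c := setAvg (cube z (2 * (n * (2 * (n * r))))) b
    (∀ᵐ y ∂volume.restrict (cube z r),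
      Integrable (fun w ↦ Ω (y - w) * ‖y - w‖ ^ (α - n) * f w) ∧
      Integrable fun w ↦ Ω (y - w) * ‖y - w‖ ^ (α - n) * ((b w - c) * f w)) ∧
    IntegrableOn (fun w ↦ Ω (z - w) * ‖z - w‖ ^ (α - n) * ((b w - c) * f w))
      (cube z (2 * (n * r)))ᶜ := by
  intro c
  have he : α - n < 0 := by linarith
  have hen : 0 < α - n + n := by linarith
  have hed : α - n + (n - n / p) < 0 := by
    have : α < n / p := by rwa [lt_div_iff₀ (by linarith), mul_comm, ← lt_div_iff₀ hα0]
    linarith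
  have hR0 : 0 < 2 * (n * r) := by positivity
  have hbm : AEStronglyMeasurable b := hb.1.aestronglyMeasurable
  have hgm : AEStronglyMeasurable (fun w ↦ (b w - c) * f w) :=
    (hbm.sub aestronglyMeasurable_const).mul hf.aestronglyMeasurable
  obtain ⟨C, hC, hgrowth⟩ := exists_lintegral_cube_pow_enorm_sub_mul_le_lpNorm hn hp1
  have hgr := hgrowth b hb f hf.aemeasurable z _ hR0
  simp_rw [← enorm_mul] at hgr
  have hB : C * bmoNorm b * lpNorm p f ≠ ∞ :=
    ENNReal.mul_ne_top (ENNReal.mul_ne_top hC hb.2) hfp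
  refine ⟨?_, ?_⟩
  · filter_upwards [ae_lintegral_rpow_mul_lt_top hn he hen hed hf.enorm.aemeasurable hfp hr
        (fun k ↦ lintegral_cube_pow_enorm_le_lpNorm hp1 hf.aemeasurable z hR0 k),
      ae_lintegral_rpow_mul_lt_top hn he hen hed hgm.enorm hB hr hgr] with y hy1 hy2
    exact ⟨integrable_kernel_mul hΩ hM0 hM hf.aestronglyMeasurable hy1,
      integrable_kernel_mul hΩ hM0 hM hgm hy2⟩
  · refine integrable_kernel_mul hΩ hM0 hM hgm.restrict ?_
    simp_rw [norm_sub_rev z]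
    exact (lintegral_compl_cube_ne_top he.le hed hB hR0 hgr).lt_top

theorem exists_lintegral_cube_enorm_commutatorOp_add_le (hn : 1 ≤ n) {α p η : ℝ} (hα0 : 0 < α)
    (hαn : α < n) (hp1 : 1 < p) (hp : p < n / α) (hη : 1 < η)
    {Ω : EuclideanSpace ℝ (Fin n) → ℝ} (hhom : HomogZero Ω) {L : NNReal}
    (hlip : LipschitzOnWith L Ω (sphere (0 : EuclideanSpace ℝ (Fin n)) 1)) :
    Measurable Ω ∧ ∃ C : ℝ≥0∞, C ≠ ∞ ∧ ∀ b : EuclideanSpace ℝ (Fin n) → ℝ, MemBMO b →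
      ∀ f : EuclideanSpace ℝ (Fin n) → ℝ, Measurable f → lpNorm p f ≠ ∞ →
      ∀ (x z : EuclideanSpace ℝ (Fin n)) (r : ℝ), 0 < r → x ∈ cube z r → ∃ a : ℝ,
        ∫⁻ y in cube z r, ‖commutatorOp Ω α b f y - a‖ₑ ≤
          C * bmoNorm b * (fracMax 0 (fun y ↦ |fracInt Ω α f y| ^ η) x ^ (1 / η) +
            fracMax (α * η) (fun y ↦ |f y| ^ η) x ^ (1 / η)) * volume (cube z r) := by
  have hn1 : (1 : ℝ) ≤ n := by exact_mod_cast hn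
  have he : α - n < 0 := by linarith
  have hen : 0 < α - n + n := by linarith
  have hΩ : Measurable Ω := hhom.measurable hlip.continuousOn
  obtain ⟨M, hM0, hM⟩ := hhom.exists_kernel_bound hlip.continuousOn he
  obtain ⟨M', hM0', hM'⟩ := hhom.exists_kernel_sub_bound hlip he
  obtain ⟨C₁, hC₁, h₁⟩ := exists_lintegral_cube_pow_enorm_sub_mul_le_fracMax hn hη 0
  obtain ⟨C₂, hC₂, h₂⟩ := exists_lintegral_cube_pow_enorm_sub_mul_le_fracMax hn hη α
  obtain ⟨C₃, hC₃, h₃⟩ := exists_lintegral_cube_lintegral_cube_le he hen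
  obtain ⟨C₄, hC₄, h₄⟩ := exists_lintegral_compl_cube_rpow_mul_le n
    (e := α - n - 1) (d := n - α) (by linarith) (by linarith)
  refine ⟨hΩ, ENNReal.ofReal (2 * n) ^ n * (C₁ + ENNReal.ofReal M * C₃ * C₂) +
    ENNReal.ofReal (M' / 4) * C₄ * C₂, by finiteness, fun b hb f hf hfp x z r hr hx ↦ ?_⟩
  set R : ℝ := 2 * (n * r) with hR
  have hR0 : 0 < R := by positivity
  have hrR : r ≤ R := by nlinarith
  set c := setAvg (cube z (2 * (n * R))) b with hc
  set A := fracMax 0 (fun y ↦ |fracInt Ω α f y| ^ η) x ^ (1 / η) with hA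
  set B := fracMax (α * η) (fun y ↦ |f y| ^ η) x ^ (1 / η) with hB
  have hxR : x ∈ cube z R := cube_subset_cube z hrR hx
  obtain ⟨hae, hz⟩ := ae_commutator_kernel_integrable hn hα0 hαn hp1 hp hΩ hM0 hM hb hf hfp z hr
  refine ⟨-∫ w in (cube z R)ᶜ, Ω (z - w) * ‖z - w‖ ^ (α - n) * ((b w - c) * f w), ?_⟩
  have hbm : AEStronglyMeasurable b := hb.1.aestronglyMeasurable
  have hTm : AEStronglyMeasurable (fracInt Ω α f) :=
    aestronglyMeasurable_fracInt hΩ α hf.aestronglyMeasurable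
  have hhm : AEMeasurable fun w ↦ ‖b w - c‖ₑ * ‖f w‖ₑ :=
    (hbm.sub aestronglyMeasurable_const).enorm.mul hf.enorm.aemeasurable
  have hvolR : ENNReal.ofReal (R ^ (n : ℝ)) = ENNReal.ofReal (2 * n) ^ n * volume (cube z r) := by
    rw [← volume_cube z hR0.le, hR, ← mul_assoc, volume_cube_mul z (by positivity) hr.le]
  have t₁ : ∫⁻ y in cube z r, ‖b y - c‖ₑ * ‖fracInt Ω α f y‖ₑ ≤
      C₁ * bmoNorm b * A * (ENNReal.ofReal (2 * n) ^ n * volume (cube z r)) := by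
    refine (lintegral_mono_set (cube_subset_cube z hrR)).trans ?_
    have := h₁ b hb _ hTm.aemeasurable x z R hR0 hxR 0
    rwa [pow_zero, one_mul, Nat.cast_zero, zero_add, mul_one, zero_mul, sub_zero, hvolR] at this
  have g₂ := h₂ b hb f hf.aemeasurable x z R hR0 hxR
  have t₂ : ∫⁻ y in cube z r, ∫⁻ w in cube z R,
        ENNReal.ofReal (‖y - w‖ ^ (α - n)) * (‖b w - c‖ₑ * ‖f w‖ₑ) ≤
      C₃ * (C₂ * bmoNorm b * B) * (ENNReal.ofReal (2 * n) ^ n * volume (cube z r)) := by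
    refine (lintegral_mono_set (cube_subset_cube z hrR)).trans ((h₃ _ hhm z R hR0).trans ?_)
    have := g₂ 0
    rw [pow_zero, one_mul, Nat.cast_zero, zero_add, mul_one] at this
    refine (mul_le_mul_right this _).trans_eq ?_
    rw [← hvolR, show R ^ (n : ℝ) = R ^ (α - n + n) * R ^ (n - α) by
      rw [← Real.rpow_add hR0]; congr 1; ring, ENNReal.ofReal_mul (by positivity)]
    ring
  have t₃ : ENNReal.ofReal (M' * (n * (r / 2))) * ∫⁻ w in (cube z R)ᶜ,
        ENNReal.ofReal (‖w - z‖ ^ (α - n - 1)) * (‖b w - c‖ₑ * ‖f w‖ₑ) ≤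
      ENNReal.ofReal (M' / 4) * C₄ * (C₂ * bmoNorm b * B) := by
    have hM4 : ENNReal.ofReal (M' / 4) =
        ENNReal.ofReal (M' * (n * (r / 2))) * ENNReal.ofReal (R ^ (α - n - 1 + (n - α))) := by
      rw [← ENNReal.ofReal_mul (by positivity), show α - n - 1 + (n - α) = -1 by ring,
        Real.rpow_neg_one, hR]
      field_simp
      ring_nf
    refine (mul_le_mul_right (h₄ _ _ z R hR0 g₂) _).trans_eq ?_
    rw [hM4, hB]
    ring
  have hk : Measurable fun q : EuclideanSpace ℝ (Fin n) × EuclideanSpace ℝ (Fin n) ↦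
      ENNReal.ofReal (‖q.1 - q.2‖ ^ (α - n)) := by fun_prop
  have hlocm : AEMeasurable (fun y ↦ ∫⁻ w in cube z R,
      ENNReal.ofReal (‖y - w‖ ^ (α - n)) * (‖b w - c‖ₑ * ‖f w‖ₑ)) :=
    (hk.aemeasurable.mul hhm.restrict.comp_snd).lintegral_prod_right'
  calc _ ≤ ∫⁻ y in cube z r, (‖b y - c‖ₑ * ‖fracInt Ω α f y‖ₑ +
        ENNReal.ofReal M * (∫⁻ w in cube z R,
          ENNReal.ofReal (‖y - w‖ ^ (α - n)) * (‖b w - c‖ₑ * ‖f w‖ₑ)) +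
        ENNReal.ofReal (M' / 4) * C₄ * (C₂ * bmoNorm b * B)) := by
        refine lintegral_mono_ae ?_
        filter_upwards [hae, ae_restrict_mem (measurableSet_cube z hr.le)] with y hy hyz
        rw [sub_neg_eq_add]
        exact (enorm_commutatorOp_add_le hM0 hM hM0' hM' c hr hyz hy.1 hy.2 hz).trans
          (add_le_add_right t₃ _)
    _ = (∫⁻ y in cube z r, ‖b y - c‖ₑ * ‖fracInt Ω α f y‖ₑ) +
        ENNReal.ofReal M * (∫⁻ y in cube z r, ∫⁻ w in cube z R,
          ENNReal.ofReal (‖y - w‖ ^ (α - n)) * (‖b w - c‖ₑ * ‖f w‖ₑ)) +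
        ENNReal.ofReal (M' / 4) * C₄ * (C₂ * bmoNorm b * B) * volume (cube z r) := by
        rw [lintegral_add_right _ measurable_const, lintegral_const,
          Measure.restrict_apply_univ, lintegral_add_right' _ (hlocm.restrict.const_mul _),
          lintegral_const_mul' _ _ ENNReal.ofReal_ne_top]
    _ ≤ C₁ * bmoNorm b * A * (ENNReal.ofReal (2 * n) ^ n * volume (cube z r)) +
        ENNReal.ofReal M *
          (C₃ * (C₂ * bmoNorm b * B) * (ENNReal.ofReal (2 * n) ^ n * volume (cube z r))) +
        ENNReal.ofReal (M' / 4) * C₄ * (C₂ * bmoNorm b * B) * volume (cube z r) := by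
        gcongr
    _ ≤ C₁ * bmoNorm b * (A + B) * (ENNReal.ofReal (2 * n) ^ n * volume (cube z r)) +
        ENNReal.ofReal M *
          (C₃ * (C₂ * bmoNorm b * (A + B)) * (ENNReal.ofReal (2 * n) ^ n * volume (cube z r))) +
        ENNReal.ofReal (M' / 4) * C₄ * (C₂ * bmoNorm b * (A + B)) * volume (cube z r) := by
        gcongr <;> simp
    _ = _ := by ring

theorem sharpMax_le_of_forall_cube {F : EuclideanSpace ℝ (Fin n) → ℝ} (hF : AEMeasurable F)
    {x : EuclideanSpace ℝ (Fin n)} {X : ℝ≥0∞}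
    (h : ∀ (z : EuclideanSpace ℝ (Fin n)) (r : ℝ), 0 < r → x ∈ cube z r →
      ∃ a : ℝ, ∫⁻ y in cube z r, ‖F y - a‖ₑ ≤ X * volume (cube z r)) :
    sharpMax F x ≤ 2 * X := by
  refine iSup_le fun z ↦ iSup_le fun r ↦ iSup_le fun hr ↦ iSup_le fun hx ↦ ?_
  obtain ⟨a, ha⟩ := h z r hr hx
  exact inv_volume_mul_lintegral_sub_setAvg_le hF (volume_cube_ne_zero z hr)
    (volume_cube_ne_top z hr.le) a ha

end SharpEstimate

theorem statement9 (n : ℕ) (hn : 1 ≤ n) (α p q η : ℝ) (hα0 : 0 < α) (hαn : α < n)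
    (hp1 : 1 < p) (hp : p < n / α) (hq : 1 / q = 1 / p - α / n)
    (hη1 : 1 < η) (hη : η < n / α)
    (Ω : EuclideanSpace ℝ (Fin n) → ℝ) (hhom : HomogZero Ω) (hmean : MeanZeroOnSphere Ω)
    (L : NNReal) (hlip : LipschitzOnWith L Ω (sphere (0 : EuclideanSpace ℝ (Fin n)) 1)) :
    ∃ C > (0 : ℝ), ∀ b : EuclideanSpace ℝ (Fin n) → ℝ, MemBMO b →
      ∀ f : EuclideanSpace ℝ (Fin n) → ℝ, Measurable f → lpNorm p f ≠ ∞ → ∀ x : EuclideanSpace ℝ (Fin n),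
        sharpMax (commutatorOp Ω α b f) x ≤
          ENNReal.ofReal C * bmoNorm b *
            ((fracMax 0 (fun y => |fracInt Ω α f y| ^ η) x) ^ (1 / η) +
              (fracMax (α * η) (fun y => |f y| ^ η) x) ^ (1 / η)) := by

  obtain ⟨hΩ, C, hC, h⟩ :=
    exists_lintegral_cube_enorm_commutatorOp_add_le hn hα0 hαn hp1 hp hη1 hhom hlip
  refine ⟨2 * C.toReal + 1, by positivity, fun b hb f hf hfp x ↦ ?_⟩
  have hbm : AEStronglyMeasurable b := hb.1.aestronglyMeasurable
  have hF : AEStronglyMeasurable (commutatorOp Ω α b f) :=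
    (hbm.mul (aestronglyMeasurable_fracInt hΩ α hf.aestronglyMeasurable)).sub
      (aestronglyMeasurable_fracInt hΩ α (hbm.mul hf.aestronglyMeasurable))
  refine (sharpMax_le_of_forall_cube hF.aemeasurable (h b hb f hf hfp x)).trans ?_
  rw [← mul_assoc, ← mul_assoc]
  gcongr
  rw [ENNReal.ofReal_add (by positivity) zero_le_one, ENNReal.ofReal_mul zero_le_two,
    ENNReal.ofReal_toReal hC, ENNReal.ofReal_ofNat]
  exact le_self_add

end
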